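/- arXiv:2110.12980 — 9 statements merged into one kernel-verified Lean document; each statement's English description precedes it below -/
import Mathlib

section
/- Let u > 0 and ε ∈ (0,1), and let w ≤ −1 be a real number satisfying w·e^w = −e^{−u−1} (i.e. w = W₋₁(−e^{−u−1})). Then (1−ε)·u − 2/ε < −w − 1 − √(2u) < u. -/
/-- The quadratic Taylor polynomial of `exp` is a strict lower bound on the positive axis. -/
theorem quadratic_lt_exp_of_pos {t : ℝ} (ht : 0 < t) : 1 + t + t ^ 2 / 2 < Real.exp t := by
  have h := Real.sum_le_exp_of_nonneg ht.le 4
  simp only [Finset.sum_range_succ, Finset.sum_range_zero, Nat.factorial] at h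
  norm_num at h
  linarith [pow_pos ht 3]

/-- Lambert `W₋₁` estimate: for `u > 0`, `ε ∈ (0,1)`, and `w = W₋₁(-e^{-u-1})`
(characterized as the unique `w ≤ -1` with `w·e^w = -e^{-u-1}`), one has
`(1-ε)·u - 2/ε < -w - 1 - √(2u) < u`. -/
theorem lambertWm1_estimate (u ε w : ℝ) (hu : 0 < u) (hε : ε ∈ Set.Ioo (0:ℝ) 1)
    (hw : w ≤ -1) (hW : w * Real.exp w = -Real.exp (-u - 1)) :
    (1 - ε) * u - 2 / ε < -w - 1 - Real.sqrt (2 * u) ∧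
      -w - 1 - Real.sqrt (2 * u) < u := by
  obtain ⟨hε0, -⟩ := hε
  obtain ⟨t, ht⟩ : ∃ t, t = -w - 1 - u := ⟨_, rfl⟩
  have hexp : Real.exp t = -w := by
    rw [show t = (-u - 1) - w by linarith, Real.exp_sub, div_eq_iff (Real.exp_pos w).ne']
    linarith
  have ht0 : 0 < t := by
    have h : 0 ≤ t := Real.exp_le_exp.mp (by rw [Real.exp_zero]; linarith)
    refine h.lt_of_ne fun h0 => ?_
    rw [← h0, Real.exp_zero] at hexp
    linarith
  have hs : 0 < Real.sqrt (2 * u) := Real.sqrt_pos.mpr (by linarith)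
  have hsq : Real.sqrt (2 * u) ^ 2 = 2 * u := Real.sq_sqrt (by linarith)
  constructor
  · generalize Real.sqrt (2 * u) = s at hs hsq ⊢
    have amgm : 2 * s ≤ ε * u + 2 / ε := by
      have h : ε * u + 2 / ε - 2 * s
          = (ε * s - 2) ^ 2 / (2 * ε) := by
        field_simp
        linear_combination (-ε ^ 2) * hsq
      have : 0 ≤ (ε * s - 2) ^ 2 / (2 * ε) := by positivity
      linarith
    linarith
  · have : t < Real.sqrt (2 * u) :=
      Real.lt_sqrt_of_sq_lt (by linarith [quadratic_lt_exp_of_pos ht0])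
    linarith
end

section
/- Let λ_app : (s₀,∞) → (0,λ₀) be differentiable with J(λ_app(s)) = s for every s > s₀, and define b_app(s) := λ_app(s)^{α/2} · √(β₁' − (2β₁/(2−α))·log λ_app(s)). Then for every s > s₀: λ_app'(s) = −b_app(s)·λ_app(s), and b_app'(s) = −( b_app(s)² + β₁·λ_app(s)^α·log λ_app(s) − β₂·λ_app(s)^α ); that is, (λ_app, b_app) solves the approximate blow-up law ∂b/∂s + b² + β₁λ^α log λ − β₂λ^α = 0, (1/λ)∂λ/∂s + b = 0. -/
open MeasureTheory in
/-- The function `l ↦ ∫ μ in l..b, f μ` has derivative `-f l` at every `l ∈ (a, b)`, if `f` is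
continuous on `(a, b]`. -/
theorem hasDerivAt_integral_left_of_continuousOn_Ioc {f : ℝ → ℝ} {a b l : ℝ}
    (hf : ContinuousOn f (Set.Ioc a b)) (hl : l ∈ Set.Ioo a b) :
    HasDerivAt (fun x => ∫ μ in x..b, f μ) (-f l) l := by
  have hcont : ContinuousOn f (Set.Ioo a b) := hf.mono Set.Ioo_subset_Ioc_self
  refine intervalIntegral.integral_hasDerivAt_left ?_
    (hcont.stronglyMeasurableAtFilter isOpen_Ioo l hl)
    (hcont.continuousAt (isOpen_Ioo.mem_nhds hl))
  refine (hf.mono ?_).intervalIntegrable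
  rw [Set.uIcc_of_le hl.2.le]
  exact fun x hx => ⟨hl.1.trans_le hx.1, hx.2⟩

/-- If `F ∘ u` is the identity near `s` and `F` has derivative `c` at `u s`, then the derivative
of a differentiable `u` at `s` is `c⁻¹`. -/
theorem hasDerivAt_of_eventually_rightInverse {F u : ℝ → ℝ} {c s : ℝ}
    (hF : HasDerivAt F c (u s)) (hu : DifferentiableAt ℝ u s)
    (hFu : ∀ᶠ t in nhds s, F (u t) = t) : HasDerivAt u c⁻¹ s := by
  have h : c * deriv u s = 1 :=
    ((hF.comp s hu.hasDerivAt).congr_of_eventuallyEq (f₁ := id)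
      (hFu.mono fun t ht => ht.symm)).unique (hasDerivAt_id s)
  rw [← eq_inv_of_mul_eq_one_right h]
  exact hu.hasDerivAt


/-- The pair `(λ_app, b_app)` with `J(λ_app(s)) = s` and
`b_app = λ_app^{α/2}·√(β₁' - (2β₁/(2-α))·log λ_app)` solves the approximate blow-up law
`∂b/∂s + b² + β₁λ^α log λ - β₂λ^α = 0`, `(1/λ)∂λ/∂s + b = 0`. -/
theorem approx_blowup_law (α β₁ β₂ β₁' l₀ s₀ : ℝ)
    (hα : α ∈ Set.Ioo (0:ℝ) 2) (hβ₁ : 0 < β₁) (hl₀ : l₀ ∈ Set.Ioo (0:ℝ) 1)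
    (hβ₁' : β₁' = -2 * β₁ / (2 - α) ^ 2 + 2 * β₂ / (2 - α))
    (hg : ∀ μ ∈ Set.Ioc (0:ℝ) l₀, 0 < β₁' - 2 * β₁ / (2 - α) * Real.log μ)
    (J : ℝ → ℝ)
    (hJ : ∀ l ∈ Set.Ioc (0:ℝ) l₀,
      J l = ∫ μ in l..l₀,
        μ ^ (-(α / 2 + 1)) * (β₁' - 2 * β₁ / (2 - α) * Real.log μ) ^ (-(1:ℝ) / 2))
    (lapp bapp : ℝ → ℝ)
    (hlapp_mem : ∀ s, s₀ < s → lapp s ∈ Set.Ioo (0:ℝ) l₀)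
    (hlapp_diff : ∀ s, s₀ < s → DifferentiableAt ℝ lapp s)
    (hlapp_J : ∀ s, s₀ < s → J (lapp s) = s)
    (hbapp : ∀ s, s₀ < s → bapp s = lapp s ^ (α / 2) *
      Real.sqrt (β₁' - 2 * β₁ / (2 - α) * Real.log (lapp s))) :
    ∀ s, s₀ < s →
      HasDerivAt lapp (-(bapp s * lapp s)) s ∧
      HasDerivAt bapp
        (-((bapp s) ^ 2 + β₁ * lapp s ^ α * Real.log (lapp s) - β₂ * lapp s ^ α)) s := by
  intro s hs
  obtain ⟨hpos, hlt⟩ := hlapp_mem s hs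
  have hs_nhds : ∀ᶠ t in nhds s, s₀ < t := lt_mem_nhds hs
  have hα2 : 2 - α ≠ 0 := (sub_pos.2 hα.2).ne'
  have hgs := hg _ ⟨hpos, hlt.le⟩
  have hcont : ContinuousOn (fun μ : ℝ => μ ^ (-(α / 2 + 1)) *
      (β₁' - 2 * β₁ / (2 - α) * Real.log μ) ^ (-(1:ℝ) / 2)) (Set.Ioc 0 l₀) := by
    refine ContinuousOn.mul
      (continuousOn_id.rpow_const fun μ hμ => Or.inl hμ.1.ne')
      (ContinuousOn.rpow_const ?_ fun μ hμ => Or.inl (hg μ hμ).ne')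
    exact continuousOn_const.sub
      (continuousOn_const.mul (Real.continuousOn_log.mono fun μ hμ => hμ.1.ne'))
  have hJ' := (hasDerivAt_integral_left_of_continuousOn_Ioc hcont ⟨hpos, hlt⟩).congr_of_eventuallyEq
    (f₁ := J) (Filter.eventually_of_mem (isOpen_Ioo.mem_nhds ⟨hpos, hlt⟩)
      fun l hl => hJ l (Set.Ioo_subset_Ioc_self hl))
  have hl := hasDerivAt_of_eventually_rightInverse hJ' (hlapp_diff s hs)
    (hs_nhds.mono fun t ht => hlapp_J t ht)
  have hl' : HasDerivAt lapp (-(bapp s * lapp s)) s := by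
    refine hl.congr_deriv (Eq.symm ?_)
    rw [hbapp s hs, Real.sqrt_eq_rpow, inv_neg, mul_inv, ← Real.rpow_neg hpos.le,
      ← Real.rpow_neg hgs.le, neg_neg, Real.rpow_add hpos, Real.rpow_one, neg_div, neg_neg]
    ring
  refine ⟨hl', ?_⟩
  have hb := ((hl'.rpow_const (p := α / 2) (Or.inl hpos.ne')).mul
    ((((hl'.log hpos.ne').const_mul (2 * β₁ / (2 - α))).const_sub β₁').sqrt
      hgs.ne')).congr_of_eventuallyEq (f₁ := bapp) (hs_nhds.mono fun t ht => hbapp t ht)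
  refine hb.congr_deriv (Eq.symm ?_)
  have hpow : lapp s ^ α = lapp s ^ (α / 2) * lapp s ^ (α / 2) := by
    rw [← Real.rpow_add hpos, add_halves]
  rw [hpow, Real.rpow_sub_one hpos.ne', hbapp s hs]
  have hsq := Real.sq_sqrt hgs.le
  have hR := (Real.sqrt_pos.2 hgs).ne'
  set R := Real.sqrt (β₁' - 2 * β₁ / (2 - α) * Real.log (lapp s))
  set P := lapp s ^ (α / 2)
  have hβ : β₁ * Real.log (lapp s) - β₂ = -(2 - α) / 2 * R ^ 2 - β₁ / (2 - α) := by
    rw [hsq, hβ₁']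
    field_simp
    ring
  have hp := hpos.ne'
  calc _ = -(P ^ 2 * (R ^ 2 + (β₁ * Real.log (lapp s) - β₂))) := by ring
    _ = _ := by
      rw [hβ]
      field_simp
      ring
end

section
/- There exist constants c₁, c₂ > 0 and λ* ∈ (0,λ₀) such that for every λ ∈ (0,λ*): c₁·λ^{−α/2}·|log λ|^{−1/2} ≤ J(λ) ≤ c₂·λ^{−α/2}·|log λ|^{−1/2}. -/
theorem intervalIntegrable_rpow_of_pos {l l₀ : ℝ} (hl : 0 < l) (hl₀ : l ≤ l₀) (r : ℝ) :
    IntervalIntegrable (fun μ : ℝ => μ ^ r) MeasureTheory.volume l l₀ := by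
  refine intervalIntegral.intervalIntegrable_rpow (Or.inr ?_)
  rw [Set.uIcc_of_le hl₀]
  exact fun h => absurd h.1 (not_le.mpr hl)

theorem integral_rpow_neg_add_one {s l l₀ : ℝ} (hs : 0 < s) (hl : 0 < l) (hl₀ : l ≤ l₀) :
    ∫ μ in l..l₀, μ ^ (-(s + 1)) = (l ^ (-s) - l₀ ^ (-s)) / s := by
  rw [integral_rpow]
  · rw [show -(s + 1) + 1 = -s by ring, div_neg, ← neg_div, neg_sub]
  · refine Or.inr ⟨by linarith, ?_⟩
    rw [Set.uIcc_of_le hl₀]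
    exact fun h => absurd h.1 (not_le.mpr hl)

/-- A positive affine function of `log` grows at most like a small power. -/
theorem sub_mul_log_le_mul_rpow {a b c γ l μ : ℝ} (ha : 0 < a) (hb : 0 < b) (hγ : 0 < γ)
    (hl : 0 < l) (hlμ : l ≤ μ) (h : γ ≤ c - b * Real.log μ) :
    c - b * Real.log l ≤ (1 + b / (γ * a)) * (μ / l) ^ a * (c - b * Real.log μ) := by
  have hμ : 0 < μ := hl.trans_le hlμ
  have h1 : 1 ≤ (μ / l) ^ a := Real.one_le_rpow ((one_le_div hl).mpr hlμ) ha.le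
  have h2 : Real.log (μ / l) ≤ (μ / l) ^ a / a := Real.log_le_rpow_div (by positivity) ha
  rw [Real.log_div hμ.ne' hl.ne'] at h2
  set R := (μ / l) ^ a
  set G := c - b * Real.log μ with hG
  have h3 : b * (Real.log μ - Real.log l) ≤ b / (γ * a) * R * G :=
    calc b * (Real.log μ - Real.log l) ≤ b * (R / a) := by gcongr
      _ = b / (γ * a) * R * γ := by field_simp
      _ ≤ b / (γ * a) * R * G := by gcongr
  have h4 : 1 * G ≤ R * G := by gcongr; exact hγ.le.trans h
  linarith

/-- Two-sided bound for the integral of a power against the inverse square root of a positive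
affine function of `log`. -/
theorem integral_rpow_mul_sub_mul_log_bounds {a b c l l₀ : ℝ} (ha : 0 < a) (hb : 0 < b)
    (hγ : 0 < c - b * Real.log l₀) (hl : 0 < l) (hl₀ : l ≤ l₀) :
    (l ^ (-a) - l₀ ^ (-a)) / a * (c - b * Real.log l) ^ (-(1 : ℝ) / 2) ≤
      ∫ μ in l..l₀, μ ^ (-(a + 1)) * (c - b * Real.log μ) ^ (-(1 : ℝ) / 2) ∧
    ∫ μ in l..l₀, μ ^ (-(a + 1)) * (c - b * Real.log μ) ^ (-(1 : ℝ) / 2) ≤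
      2 / a * (1 + b / ((c - b * Real.log l₀) * a)) ^ ((1 : ℝ) / 2) * l ^ (-a) *
        (c - b * Real.log l) ^ (-(1 : ℝ) / 2) := by
  set γ := c - b * Real.log l₀ with hγ_def
  set K := 1 + b / (γ * a) with hK_def
  have hK : 0 < K := by positivity
  have hG : ∀ μ, 0 < μ → μ ≤ l₀ → γ ≤ c - b * Real.log μ := fun μ hμ h => by
    have := Real.log_le_log hμ h
    rw [hγ_def]; gcongr
  have hint : IntervalIntegrable
      (fun μ : ℝ => μ ^ (-(a + 1)) * (c - b * Real.log μ) ^ (-(1 : ℝ) / 2))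
      MeasureTheory.volume l l₀ := by
    refine ContinuousOn.intervalIntegrable ?_
    rw [Set.uIcc_of_le hl₀]
    have hpos : ∀ μ ∈ Set.Icc l l₀, μ ≠ 0 := fun μ hμ => (hl.trans_le hμ.1).ne'
    refine (continuousOn_id.rpow_const fun μ hμ => Or.inl (hpos μ hμ)).mul
      (ContinuousOn.rpow_const ?_ fun μ hμ => Or.inl ?_)
    · exact continuousOn_const.sub (continuousOn_const.mul (continuousOn_id.log hpos))
    · exact (hγ.trans_le (hG μ (hl.trans_le hμ.1) hμ.2)).ne'
  have hGl := hγ.trans_le (hG l hl hl₀)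
  constructor
  · rw [← integral_rpow_neg_add_one ha hl hl₀, ← intervalIntegral.integral_mul_const]
    refine intervalIntegral.integral_mono_on hl₀
      ((intervalIntegrable_rpow_of_pos hl hl₀ _).mul_const _) hint fun μ hμ => ?_
    have hμ0 : 0 < μ := hl.trans_le hμ.1
    refine mul_le_mul_of_nonneg_left ?_ (by positivity)
    refine Real.rpow_le_rpow_of_nonpos (hγ.trans_le (hG μ hμ0 hμ.2)) ?_ (by norm_num)
    have := Real.log_le_log hl hμ.1
    gcongr
  · set D := K ^ ((1 : ℝ) / 2) * l ^ (-(a / 2)) * (c - b * Real.log l) ^ (-(1 : ℝ) / 2)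
    have hD : 0 ≤ D := by positivity
    calc _ ≤ ∫ μ in l..l₀, μ ^ (-(a / 2 + 1)) * D := by
          refine intervalIntegral.integral_mono_on hl₀ hint
            ((intervalIntegrable_rpow_of_pos hl hl₀ _).mul_const _) fun μ hμ => ?_
          have hμ0 : 0 < μ := hl.trans_le hμ.1
          have hGμ := hγ.trans_le (hG μ hμ0 hμ.2)
          have key := sub_mul_log_le_mul_rpow ha hb hγ hl hμ.1 (hG μ hμ0 hμ.2)
          rw [← hK_def] at key
          have hR : 0 < K * (μ / l) ^ a := by positivity
          have h1 : (c - b * Real.log μ) ^ (-(1 : ℝ) / 2) ≤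
              (K * (μ / l) ^ a) ^ ((1 : ℝ) / 2) * (c - b * Real.log l) ^ (-(1 : ℝ) / 2) := by
            have h2 := Real.rpow_le_rpow_of_nonpos hGl key
              (show -(1 : ℝ) / 2 ≤ 0 by norm_num)
            rw [Real.mul_rpow hR.le hGμ.le] at h2
            calc _ = (K * (μ / l) ^ a) ^ ((1 : ℝ) / 2) *
                  ((K * (μ / l) ^ a) ^ (-(1 : ℝ) / 2) *
                    (c - b * Real.log μ) ^ (-(1 : ℝ) / 2)) := by
                  rw [← mul_assoc, ← Real.rpow_add hR]; norm_num
              _ ≤ _ := by gcongr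
          have h3 : (K * (μ / l) ^ a) ^ ((1 : ℝ) / 2) =
              K ^ ((1 : ℝ) / 2) * (μ ^ (a / 2) * l ^ (-(a / 2))) := by
            rw [Real.mul_rpow hK.le (by positivity), ← Real.rpow_mul (by positivity),
              Real.div_rpow hμ0.le hl.le, Real.rpow_neg hl.le, mul_one_div, div_eq_mul_inv (μ ^ (a / 2))]
          rw [h3] at h1
          calc _ ≤ μ ^ (-(a + 1)) * (K ^ ((1 : ℝ) / 2) * (μ ^ (a / 2) * l ^ (-(a / 2))) *
                (c - b * Real.log l) ^ (-(1 : ℝ) / 2)) := by gcongr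
            _ = (μ ^ (-(a + 1)) * μ ^ (a / 2)) * D := by ring
            _ = μ ^ (-(a / 2 + 1)) * D := by
              rw [← Real.rpow_add hμ0]; congr 2; ring
      _ = (l ^ (-(a / 2)) - l₀ ^ (-(a / 2))) / (a / 2) * D := by
          rw [intervalIntegral.integral_mul_const,
            integral_rpow_neg_add_one (half_pos ha) hl hl₀]
      _ ≤ l ^ (-(a / 2)) / (a / 2) * D := by
          have : 0 < l₀ ^ (-(a / 2)) := Real.rpow_pos_of_pos (hl.trans_le hl₀) _
          gcongr
          linarith
      _ = 2 / a * K ^ ((1 : ℝ) / 2) * (l ^ (-(a / 2)) * l ^ (-(a / 2))) *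
            (c - b * Real.log l) ^ (-(1 : ℝ) / 2) := by
          simp only [D]; field_simp
      _ = _ := by
          rw [← Real.rpow_add hl]; congr 3; ring

/-- Below `l₀ < 1`, a positive affine function of `log` is comparable to `|log|`. -/
theorem exists_sub_mul_log_comparable_abs_log {b c l₀ : ℝ} (hb : 0 < b)
    (hl₀ : l₀ ∈ Set.Ioo (0 : ℝ) 1) (hγ : 0 < c - b * Real.log l₀) :
    ∃ m M : ℝ, 0 < m ∧ 0 < M ∧ ∀ l ∈ Set.Ioc (0 : ℝ) l₀,
      m * |Real.log l| ≤ c - b * Real.log l ∧ c - b * Real.log l ≤ M * |Real.log l| := by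
  have hL : 0 < -Real.log l₀ := neg_pos.mpr (Real.log_neg hl₀.1 hl₀.2)
  refine ⟨min ((c - b * Real.log l₀) / -Real.log l₀) b, |c| / -Real.log l₀ + b,
    lt_min (by positivity) hb, by positivity, fun l hl => ?_⟩
  have hlog : Real.log l ≤ Real.log l₀ := Real.log_le_log hl.1 hl.2
  rw [abs_of_neg (by linarith : Real.log l < 0)]
  constructor
  · have h1 := mul_le_mul_of_nonneg_right
      (min_le_left ((c - b * Real.log l₀) / -Real.log l₀) b) hL.le
    rw [div_mul_cancel₀ _ hL.ne'] at h1
    have h2 := mul_le_mul_of_nonneg_right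
      (min_le_right ((c - b * Real.log l₀) / -Real.log l₀) b) (sub_nonneg.mpr hlog)
    linarith
  · have h1 : |c| / -Real.log l₀ * -Real.log l₀ ≤ |c| / -Real.log l₀ * -Real.log l := by
      gcongr
    rw [div_mul_cancel₀ _ hL.ne'] at h1
    linarith [le_abs_self c]


/-- Two-sided bound `J(λ) ≈ λ^{-α/2}·|log λ|^{-1/2}` for `λ` small. -/
theorem J_two_sided_bound (α β₁ β₁' l₀ : ℝ)
    (hα : α ∈ Set.Ioo (0:ℝ) 2) (hβ₁ : 0 < β₁) (hl₀ : l₀ ∈ Set.Ioo (0:ℝ) 1)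
    (hg : ∀ μ ∈ Set.Ioc (0:ℝ) l₀, 0 < β₁' - 2 * β₁ / (2 - α) * Real.log μ)
    (J : ℝ → ℝ)
    (hJ : ∀ l ∈ Set.Ioc (0:ℝ) l₀,
      J l = ∫ μ in l..l₀,
        μ ^ (-(α / 2 + 1)) * (β₁' - 2 * β₁ / (2 - α) * Real.log μ) ^ (-(1:ℝ) / 2)) :
    ∃ c₁ c₂ lstar : ℝ, 0 < c₁ ∧ 0 < c₂ ∧ lstar ∈ Set.Ioo (0:ℝ) l₀ ∧
      ∀ l ∈ Set.Ioo (0:ℝ) lstar,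
        c₁ * l ^ (-(α / 2)) * |Real.log l| ^ (-(1:ℝ) / 2) ≤ J l ∧
        J l ≤ c₂ * l ^ (-(α / 2)) * |Real.log l| ^ (-(1:ℝ) / 2) := by
  obtain ⟨hα0, hα2⟩ := hα
  have ha : 0 < α / 2 := half_pos hα0
  have hb : 0 < 2 * β₁ / (2 - α) := div_pos (by positivity) (by linarith)
  have hγ := hg l₀ ⟨hl₀.1, le_rfl⟩
  obtain ⟨m, M, hm, hM, hcomp⟩ := exists_sub_mul_log_comparable_abs_log hb hl₀ hγ
  set a := α / 2
  set b := 2 * β₁ / (2 - α)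
  have h2 : (2 : ℝ) ^ (-(1 / a)) < 1 :=
    Real.rpow_lt_one_of_one_lt_of_neg one_lt_two (neg_neg_of_pos (by positivity))
  have hl₀_pos := hl₀.1
  refine ⟨1 / (2 * a) * M ^ (-(1 : ℝ) / 2),
    2 / a * (1 + b / ((β₁' - b * Real.log l₀) * a)) ^ ((1 : ℝ) / 2) * m ^ (-(1 : ℝ) / 2),
    l₀ * 2 ^ (-(1 / a)), by positivity, by positivity,
    ⟨by positivity, mul_lt_of_lt_one_right hl₀_pos h2⟩, fun l hl => ?_⟩
  have hl_pos := hl.1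
  have hl_le : l ≤ l₀ := hl.2.le.trans (mul_lt_of_lt_one_right hl₀_pos h2).le
  have hlog : 0 < |Real.log l| :=
    abs_pos.mpr (Real.log_neg hl_pos (hl_le.trans_lt hl₀.2)).ne
  obtain ⟨hlow, hupp⟩ := integral_rpow_mul_sub_mul_log_bounds ha hb hγ hl_pos hl_le
  obtain ⟨hml, hlM⟩ := hcomp l ⟨hl_pos, hl_le⟩
  have hGl := hg l ⟨hl_pos, hl_le⟩
  rw [hJ l ⟨hl_pos, hl_le⟩]
  constructor
  · refine le_trans ?_ hlow
    have hhalf : 2 * l₀ ^ (-a) ≤ l ^ (-a) := by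
      have h := Real.rpow_le_rpow_of_nonpos hl_pos hl.2.le (neg_nonpos.mpr ha.le)
      rwa [Real.mul_rpow hl₀_pos.le (by positivity), ← Real.rpow_mul zero_le_two,
        neg_mul_neg, one_div_mul_cancel ha.ne', Real.rpow_one, mul_comm] at h
    have h1 : M ^ (-(1 : ℝ) / 2) * |Real.log l| ^ (-(1 : ℝ) / 2) ≤
        (β₁' - b * Real.log l) ^ (-(1 : ℝ) / 2) := by
      rw [← Real.mul_rpow hM.le hlog.le]
      exact Real.rpow_le_rpow_of_nonpos hGl hlM (by norm_num)
    calc _ = l ^ (-a) / 2 / a * (M ^ (-(1 : ℝ) / 2) * |Real.log l| ^ (-(1 : ℝ) / 2)) := by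
          field_simp
      _ ≤ _ := by
          have h3 : l ^ (-a) / 2 ≤ l ^ (-a) - l₀ ^ (-a) := by linarith
          have h4 : 0 ≤ l ^ (-a) - l₀ ^ (-a) := le_trans (by positivity) h3
          gcongr
  · refine hupp.trans ?_
    have h1 : (β₁' - b * Real.log l) ^ (-(1 : ℝ) / 2) ≤
        m ^ (-(1 : ℝ) / 2) * |Real.log l| ^ (-(1 : ℝ) / 2) := by
      rw [← Real.mul_rpow hm.le hlog.le]
      exact Real.rpow_le_rpow_of_nonpos (by positivity) hml (by norm_num)
    calc _ ≤ 2 / a * (1 + b / ((β₁' - b * Real.log l₀) * a)) ^ ((1 : ℝ) / 2) * l ^ (-a) *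
          (m ^ (-(1 : ℝ) / 2) * |Real.log l| ^ (-(1 : ℝ) / 2)) := by gcongr
      _ = _ := by ring
end

section
/- There exist a constant C > 0 and λ* ∈ (0,λ₀) such that for every λ ∈ (0,λ*): | J(λ)^{−1} − (α/2)·√(2β₁/(2−α))·λ^{α/2}·√(|log λ|) | ≤ C·λ^{α/2}·|log λ|^{−1/2}. Equivalently, J(λ)^{−1} = (α/2)·√(2β₁/(2−α))·λ^{α/2}·√(|log λ|)·(1 + O(1/|log λ|)) as λ → 0⁺. -/
lemma hasDerivAt_rpow_mul_log_rpow {a b c p x : ℝ} (hx : 0 < x)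
    (hg : 0 < c - b * Real.log x) :
    HasDerivAt (fun x : ℝ => x ^ (-a) * (c - b * Real.log x) ^ p)
      (x ^ (-(a + 1)) * (c - b * Real.log x) ^ p * (-a - p * b / (c - b * Real.log x))) x := by
  have h1 : HasDerivAt (fun x : ℝ => x ^ (-a)) (-a * x ^ (-a - 1)) x :=
    Real.hasDerivAt_rpow_const (Or.inl hx.ne')
  have h2 : HasDerivAt (fun x : ℝ => c - b * Real.log x) (-(b * x⁻¹)) x :=
    ((Real.hasDerivAt_log hx.ne').const_mul b).const_sub c
  refine (h1.mul (h2.rpow_const (p := p) (Or.inl hg.ne'))).congr_deriv ?_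
  have e1 : -(a + 1) = -a - 1 := by ring
  rw [e1, Real.rpow_sub_one hx.ne', Real.rpow_sub_one hg.ne']
  field_simp
  ring

lemma hasDerivAt_integral_rpow_mul_log_rpow {a b c p l₀ x : ℝ} (hx : x ∈ Set.Ioo 0 l₀)
    (hg : ∀ μ ∈ Set.Ioc (0 : ℝ) l₀, 0 < c - b * Real.log μ) :
    HasDerivAt (fun l : ℝ => ∫ μ in l..l₀, μ ^ (-(a + 1)) * (c - b * Real.log μ) ^ p)
      (-(x ^ (-(a + 1)) * (c - b * Real.log x) ^ p)) x := by
  have hc : ∀ y ∈ Set.Ioc (0 : ℝ) l₀,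
      ContinuousAt (fun μ : ℝ => μ ^ (-(a + 1)) * (c - b * Real.log μ) ^ p) y := by
    intro y hy
    have hlog : ContinuousAt Real.log y := Real.continuousAt_log hy.1.ne'
    exact (Real.continuousAt_rpow_const _ _ (Or.inl hy.1.ne')).mul
      ((continuousAt_const.sub (continuousAt_const.mul hlog)).rpow_const (Or.inl (hg y hy).ne'))
  refine intervalIntegral.integral_hasDerivAt_left ?_ ?_ (hc x ⟨hx.1, hx.2.le⟩)
  · refine ContinuousOn.intervalIntegrable fun y hy => (hc y ?_).continuousWithinAt
    rw [Set.uIcc_of_le hx.2.le] at hy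
    exact ⟨hx.1.trans_le hy.1, hy.2⟩
  · have hm : Measurable (fun μ : ℝ => μ ^ (-(a + 1)) * (c - b * Real.log μ) ^ p) := by
      fun_prop
    exact hm.stronglyMeasurable.stronglyMeasurableAtFilter

/-- If `|D'| ≤ -R'` on `(0, l₁]` and `|D| ≤ R` at `l₁`, then `|D| ≤ R` on the whole interval. -/
lemma abs_le_of_deriv_le {D R D' R' : ℝ → ℝ} {l₁ : ℝ}
    (hD : ∀ x ∈ Set.Ioc 0 l₁, HasDerivAt D (D' x) x)
    (hR : ∀ x ∈ Set.Ioc 0 l₁, HasDerivAt R (R' x) x)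
    (hle : ∀ x ∈ Set.Ioc 0 l₁, |D' x| ≤ -R' x) (h₁ : |D l₁| ≤ R l₁) :
    ∀ x ∈ Set.Ioc 0 l₁, |D x| ≤ R x := by
  have anti : ∀ f f' : ℝ → ℝ, (∀ x ∈ Set.Ioc 0 l₁, HasDerivAt f (f' x) x) →
      (∀ x ∈ Set.Ioc 0 l₁, f' x ≤ 0) → ∀ x ∈ Set.Ioc 0 l₁, f l₁ ≤ f x := by
    intro f f' hf hf' x hx
    have : AntitoneOn f (Set.Ioc 0 l₁) := by
      refine antitoneOn_of_deriv_nonpos (convex_Ioc _ _)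
        (fun y hy => (hf y hy).continuousAt.continuousWithinAt)
        (fun y hy => (hf y (interior_subset hy)).differentiableAt.differentiableWithinAt)
        (fun y hy => ?_)
      rw [(hf y (interior_subset hy)).deriv]
      exact hf' y (interior_subset hy)
    exact this hx ⟨hx.1.trans_le hx.2, le_rfl⟩ hx.2
  intro x hx
  have hp := anti (fun y => R y + D y) (fun y => R' y + D' y)
    (fun y hy => (hR y hy).add (hD y hy))
    (fun y hy => by linarith [(abs_le.1 (hle y hy)).2]) x hx
  have hm := anti (fun y => R y - D y) (fun y => R' y - D' y)
    (fun y hy => (hR y hy).sub (hD y hy))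
    (fun y hy => by linarith [(abs_le.1 (hle y hy)).1]) x hx
  have h := abs_le.1 h₁
  exact abs_le.2 ⟨by linarith, by linarith⟩

lemma abs_inv_sub_inv_le {j G E : ℝ} (hG : 0 < G) (hE : |j - G| ≤ E) (hEG : E ≤ G / 2) :
    |j⁻¹ - G⁻¹| ≤ 2 * E / G ^ 2 := by
  have h := abs_le.1 hE
  have hj : G / 2 ≤ j := by linarith
  have hj0 : 0 < j := by linarith
  rw [inv_sub_inv hj0.ne' hG.ne', abs_div, abs_sub_comm, abs_of_pos (mul_pos hj0 hG),
    div_le_div_iff₀ (mul_pos hj0 hG) (by positivity)]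
  have : |j - G| * G ^ 2 ≤ E * G ^ 2 := by gcongr
  have hE0 : 0 ≤ E := (abs_nonneg _).trans hE
  nlinarith [mul_le_mul_of_nonneg_left hj (mul_nonneg hE0 hG.le)]

lemma rpow_neg_half_eq {x : ℝ} (hx : 0 ≤ x) : x ^ (-(1 : ℝ) / 2) = (√x)⁻¹ := by
  rw [neg_div, Real.rpow_neg hx, ← Real.sqrt_eq_rpow]

/-- A first-order expansion of `j ≈ 1 / (a y s)` yields one of `j⁻¹` around `a r y t`, when
`s² = c + r² t²` with `s`, `t` large. -/
lemma abs_inv_sub_le {a c r K y s t j : ℝ} (ha : 0 < a) (hr : 0 < r) (hy : 0 < y)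
    (hs : 0 < s) (ht : 0 < t) (hst : s ^ 2 = c + r ^ 2 * t ^ 2) (hrt : r * t / 2 ≤ s)
    (hK : 0 < K) (hKs : 2 * a * K ≤ s ^ 2)
    (hj : |j - 1 / a * (y⁻¹ * s⁻¹)| ≤ K * (y⁻¹ * (s⁻¹ / s ^ 2))) :
    |j⁻¹ - a * r * y * t| ≤ (4 * K * a ^ 2 / r + a * |c| / r) * y * t⁻¹ := by
  have h1 := abs_inv_sub_inv_le (by positivity) hj (by
    have : 1 / a * (y⁻¹ * s⁻¹) / 2 - K * (y⁻¹ * (s⁻¹ / s ^ 2))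
        = (y⁻¹ * s⁻¹) * (s ^ 2 - 2 * a * K) / (2 * a * s ^ 2) := by
      field_simp
    have h : 0 ≤ (y⁻¹ * s⁻¹) * (s ^ 2 - 2 * a * K) / (2 * a * s ^ 2) := by
      have := sub_nonneg.2 hKs
      positivity
    linarith)
  have e1 : 2 * (K * (y⁻¹ * (s⁻¹ / s ^ 2))) / (1 / a * (y⁻¹ * s⁻¹)) ^ 2
      = 2 * K * a ^ 2 * y * s⁻¹ := by
    field_simp
  have e2 : (1 / a * (y⁻¹ * s⁻¹))⁻¹ = a * y * s := by field_simp
  rw [e1, e2] at h1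
  have h2 : s⁻¹ ≤ 2 / r * t⁻¹ := by
    have : 2 / r * t⁻¹ = (r * t / 2)⁻¹ := by field_simp
    rw [this]
    exact inv_anti₀ (by positivity) hrt
  have h3 : |s - r * t| ≤ |c| / r * t⁻¹ := by
    have e : |c| = |s - r * t| * (s + r * t) := by
      rw [← abs_of_pos (show 0 < s + r * t by positivity), ← abs_mul]
      congr 1
      linarith
    have e' : |c| / r * t⁻¹ = |c| / (r * t) := by field_simp
    rw [e', le_div_iff₀ (by positivity), e]
    gcongr
    linarith
  calc |j⁻¹ - a * r * y * t|
      = |(j⁻¹ - a * y * s) + a * y * (s - r * t)| := by congr 1; ring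
    _ ≤ |j⁻¹ - a * y * s| + a * y * |s - r * t| := by
        refine (abs_add_le _ _).trans_eq ?_
        rw [abs_mul, abs_of_pos (show 0 < a * y by positivity)]
    _ ≤ 2 * K * a ^ 2 * y * (2 / r * t⁻¹) + a * y * (|c| / r * t⁻¹) := by
        gcongr
        exact h1.trans (by gcongr)
    _ = _ := by ring


/-- Asymptotics `J(λ)⁻¹ = (α/2)·√(2β₁/(2-α))·λ^{α/2}·√|log λ|·(1 + O(1/|log λ|))`
as `λ → 0⁺`. -/
theorem J_inv_asymptotics (α β₁ β₁' l₀ : ℝ)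
    (hα : α ∈ Set.Ioo (0:ℝ) 2) (hβ₁ : 0 < β₁) (hl₀ : l₀ ∈ Set.Ioo (0:ℝ) 1)
    (hg : ∀ μ ∈ Set.Ioc (0:ℝ) l₀, 0 < β₁' - 2 * β₁ / (2 - α) * Real.log μ)
    (J : ℝ → ℝ)
    (hJ : ∀ l ∈ Set.Ioc (0:ℝ) l₀,
      J l = ∫ μ in l..l₀,
        μ ^ (-(α / 2 + 1)) * (β₁' - 2 * β₁ / (2 - α) * Real.log μ) ^ (-(1:ℝ) / 2)) :
    ∃ C lstar : ℝ, 0 < C ∧ lstar ∈ Set.Ioo (0:ℝ) l₀ ∧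
      ∀ l ∈ Set.Ioo (0:ℝ) lstar,
        abs ((J l)⁻¹ - α / 2 * Real.sqrt (2 * β₁ / (2 - α)) * l ^ (α / 2) *
            Real.sqrt |Real.log l|)
          ≤ C * l ^ (α / 2) * |Real.log l| ^ (-(1:ℝ) / 2) := by
  obtain ⟨hα0, hα2⟩ := hα
  obtain ⟨hl0, hl1⟩ := hl₀
  have hb : 0 < 2 * β₁ / (2 - α) := div_pos (by linarith) (by linarith)
  generalize 2 * β₁ / (2 - α) = b at *
  have ha : 0 < α / 2 := by linarith
  generalize α / 2 = a at *
  set g : ℝ → ℝ := fun x => β₁' - b * Real.log x with hgdef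
  obtain ⟨M, hM⟩ : ∃ M : ℝ, M = 2 * |β₁'| / b + 6 / a := ⟨_, rfl⟩
  have hM0 : 0 < M := by rw [hM]; positivity
  have hbM : b * M = 2 * |β₁'| + 6 * b / a := by rw [hM]; field_simp
  obtain ⟨l₁, hl₁⟩ : ∃ l₁, l₁ = min (l₀ / 2) (Real.exp (-M)) := ⟨_, rfl⟩
  have hl₁0 : 0 < l₁ := by rw [hl₁]; exact lt_min (by linarith) (Real.exp_pos _)
  have hl₁l₀ : l₁ < l₀ := by rw [hl₁]; exact (min_le_left _ _).trans_lt (by linarith)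
  have hlog : ∀ x ∈ Set.Ioc 0 l₁, M ≤ -Real.log x := by
    intro x hx
    have := (Real.log_le_iff_le_exp hx.1).2 (hx.2.trans (hl₁.trans_le (min_le_right _ _)))
    linarith
  have hbg : ∀ x ∈ Set.Ioc 0 l₁, b * -Real.log x / 2 ≤ g x ∧ 3 * b / a ≤ g x := by
    intro x hx
    have h := mul_le_mul_of_nonneg_left (hlog x hx) hb.le
    have h' := neg_abs_le β₁'
    have h'' := abs_nonneg β₁'
    have e : 6 * b / a = 2 * (3 * b / a) := by ring
    have : 0 < 3 * b / a := by positivity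
    simp only [hgdef]
    constructor <;> linarith
  have hgp : ∀ x ∈ Set.Ioc 0 l₁, 0 < g x := fun x hx => hg x ⟨hx.1, hx.2.trans hl₁l₀.le⟩
  have hsplit : ∀ x ∈ Set.Ioc 0 l₁, g x ^ (-(3 : ℝ) / 2) = g x ^ (-(1 : ℝ) / 2) / g x := by
    intro x hx
    rw [← Real.rpow_sub_one (hgp x hx).ne']
    norm_num
  set D : ℝ → ℝ := fun x => J x - 1 / a * (x ^ (-a) * g x ^ (-(1 : ℝ) / 2)) with hD
  set R : ℝ → ℝ := fun x => x ^ (-a) * g x ^ (-(3 : ℝ) / 2) with hR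
  have hRp : 0 < R l₁ :=
    mul_pos (Real.rpow_pos_of_pos hl₁0 _) (Real.rpow_pos_of_pos (hgp l₁ ⟨hl₁0, le_rfl⟩) _)
  obtain ⟨K, hK⟩ : ∃ K, K = b / a ^ 2 + |D l₁| / R l₁ := ⟨_, rfl⟩
  have hK0 : 0 < K := by rw [hK]; positivity
  have hKa : b / a ^ 2 ≤ K := by rw [hK]; linarith [show 0 ≤ |D l₁| / R l₁ by positivity]
  have hDR : ∀ x ∈ Set.Ioc 0 l₁, |D x| ≤ K * R x := by
    refine abs_le_of_deriv_le
      (D' := fun x => -(x ^ (-(a + 1)) * g x ^ (-(1 : ℝ) / 2))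
        - 1 / a * (x ^ (-(a + 1)) * g x ^ (-(1 : ℝ) / 2) * (-a - -(1 : ℝ) / 2 * b / g x)))
      (R' := fun x => K * (x ^ (-(a + 1)) * g x ^ (-(3 : ℝ) / 2)
        * (-a - -(3 : ℝ) / 2 * b / g x))) ?_ ?_ ?_ ?_
    · intro x hx
      refine HasDerivAt.sub ?_ ((hasDerivAt_rpow_mul_log_rpow hx.1 (hgp x hx)).const_mul _)
      refine (hasDerivAt_integral_rpow_mul_log_rpow
        ⟨hx.1, hx.2.trans_lt hl₁l₀⟩ hg).congr_of_eventuallyEq ?_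
      filter_upwards [Ioo_mem_nhds hx.1 (hx.2.trans_lt hl₁l₀)] with y hy
      exact hJ y ⟨hy.1, hy.2.le⟩
    · intro x hx
      exact (hasDerivAt_rpow_mul_log_rpow hx.1 (hgp x hx)).const_mul K
    · intro x hx
      have hgx := hgp x hx
      have hw : 0 < x ^ (-(a + 1)) * g x ^ (-(1 : ℝ) / 2) / g x :=
        div_pos (mul_pos (Real.rpow_pos_of_pos hx.1 _) (Real.rpow_pos_of_pos hgx _)) hgx
      have hq : 3 / 2 * b / g x ≤ a / 2 := by
        have := (hbg x hx).2
        rw [div_le_iff₀ ha] at this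
        rw [div_le_iff₀ hgx]
        linarith
      have hKb : b / (2 * a) ≤ K * (a / 2) := by
        have := mul_le_mul_of_nonneg_right hKa (show 0 ≤ a / 2 by positivity)
        have e : b / a ^ 2 * (a / 2) = b / (2 * a) := by field_simp
        linarith
      simp only [hsplit x hx]
      generalize x ^ (-(a + 1)) = u at *
      generalize g x ^ (-(1 : ℝ) / 2) = v at *
      have e1 : -(u * v) - 1 / a * (u * v * (-a - -(1 : ℝ) / 2 * b / g x))
          = -(u * v / g x * (b / (2 * a))) := by
        field_simp
        ring
      have e2 : -(K * (u * (v / g x) * (-a - -(3 : ℝ) / 2 * b / g x)))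
          = u * v / g x * (K * (a - 3 / 2 * b / g x)) := by
        ring
      rw [e1, e2, abs_neg, abs_of_pos (by positivity)]
      refine mul_le_mul_of_nonneg_left (hKb.trans ?_) hw.le
      exact mul_le_mul_of_nonneg_left (by linarith) hK0.le
    · rw [← div_le_iff₀ hRp, hK]
      linarith [show 0 < b / a ^ 2 by positivity]
  have hrb : 0 < √b := Real.sqrt_pos.2 hb
  refine ⟨4 * K * a ^ 2 / √b + a * |β₁'| / √b, min l₁ (Real.exp (-(4 * a * K / b))),
    by positivity, ⟨lt_min hl₁0 (Real.exp_pos _), (min_le_left _ _).trans_lt hl₁l₀⟩, ?_⟩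
  intro l hl
  have hl' : l ∈ Set.Ioc 0 l₁ := ⟨hl.1, hl.2.le.trans (min_le_left _ _)⟩
  have hgl := hgp l hl'
  have hLM := hlog l hl'
  have hL : 4 * a * K / b ≤ -Real.log l := by
    have := (Real.log_le_iff_le_exp hl.1).2 (hl.2.le.trans (min_le_right _ _))
    linarith
  have hg2 := (hbg l hl').1
  have hLabs : |Real.log l| = -Real.log l := abs_of_neg (by linarith)
  have hL0 : 0 < -Real.log l := by linarith
  have hDl := hDR l hl'
  simp only [hD, hR, hsplit l hl'] at hDl
  rw [hLabs, rpow_neg_half_eq hL0.le]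
  rw [rpow_neg_half_eq hgl.le, Real.rpow_neg hl.1.le, ← Real.sq_sqrt hgl.le,
    Real.sqrt_sq (Real.sqrt_nonneg _)] at hDl
  refine abs_inv_sub_le ha hrb (Real.rpow_pos_of_pos hl.1 _) (Real.sqrt_pos.2 hgl)
    (Real.sqrt_pos.2 hL0) ?_ ?_ hK0 ?_ hDl
  · rw [Real.sq_sqrt hgl.le, Real.sq_sqrt hb.le, Real.sq_sqrt hL0.le]
    simp only [hgdef]
    ring
  · refine Real.le_sqrt_of_sq_le ?_
    rw [div_pow, mul_pow, Real.sq_sqrt hb.le, Real.sq_sqrt hL0.le]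
    nlinarith [mul_pos hb hL0]
  · rw [Real.sq_sqrt hgl.le]
    rw [div_le_iff₀ hb] at hL
    linarith
end

section
/- There exists a constant C > 0 such that for every λ ∈ (0,λ₀]: |𝓕(λ) − J(λ)| ≤ C·( λ^{−α/4} + λ^{2−(3/2)α} ). -/
open Set Filter Topology in
/-- A positive continuous function on `(0, b]` that blows up at `0` is bounded away from zero. -/
lemma exists_pos_lower_bound_of_tendsto_atTop {f : ℝ → ℝ} {b : ℝ}
    (hf : ContinuousOn f (Ioc 0 b)) (hpos : ∀ x ∈ Ioc 0 b, 0 < f x)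
    (hlim : Tendsto f (𝓝[>] 0) atTop) :
    ∃ m, 0 < m ∧ ∀ x ∈ Ioc 0 b, m ≤ f x := by
  obtain ⟨ε, hε, hε'⟩ := mem_nhdsGT_iff_exists_Ioo_subset.1 (hlim.eventually_ge_atTop 1)
  have hsub : Icc ε b ⊆ Ioc 0 b := fun x hx => ⟨lt_of_lt_of_le hε hx.1, hx.2⟩
  obtain ⟨m, hm, hm'⟩ := isCompact_Icc.exists_forall_le' (hf.mono hsub)
    fun x hx => hpos x (hsub hx)
  refine ⟨min m 1, by positivity, fun x hx => ?_⟩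
  rcases lt_or_ge x ε with h | h
  · exact (min_le_right _ _).trans (hε' ⟨hx.1, h⟩)
  · exact (min_le_left _ _).trans (hm' x ⟨h, hx.2⟩)

/-- `x ↦ x ^ (-1/2)` is Lipschitz on `[m, ∞)`. -/
lemma abs_rpow_neg_half_sub_le {m a b : ℝ} (hm : 0 < m) (ha : m ≤ a) (hb : m ≤ b) :
    |a ^ (-(1:ℝ) / 2) - b ^ (-(1:ℝ) / 2)| ≤ (m * √m)⁻¹ * |a - b| := by
  have key : ∀ x : ℝ, m ≤ x → x ^ (-(1:ℝ) / 2) = (√x)⁻¹ := fun x hx => by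
    rw [Real.sqrt_eq_rpow, ← Real.rpow_neg (hm.le.trans hx), neg_div]
  have hA : √m ≤ √a := Real.sqrt_le_sqrt ha
  have hB : √m ≤ √b := Real.sqrt_le_sqrt hb
  have hM : 0 < √m := Real.sqrt_pos.2 hm
  have hA0 : 0 < √a := hM.trans_le hA
  have hB0 : 0 < √b := hM.trans_le hB
  have hdiff : (√a)⁻¹ - (√b)⁻¹ = (√a * √b * (√a + √b))⁻¹ * (b - a) := by
    nth_rewrite 4 [← Real.sq_sqrt (hm.le.trans ha)]
    nth_rewrite 4 [← Real.sq_sqrt (hm.le.trans hb)]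
    field_simp
    ring
  rw [key a ha, key b hb, hdiff, abs_mul, abs_sub_comm b a, abs_of_pos (by positivity)]
  gcongr
  calc m = √m * √m := (Real.mul_self_sqrt hm.le).symm
    _ ≤ √a * √b := by gcongr
  linarith

/-- For `r < 0`, the integral of `x ^ (r - 1)` over `[a, b]` is controlled by `a ^ r`. -/
lemma integral_rpow_sub_one_le {r a b : ℝ} (hr : r < 0) (ha : 0 < a) (hab : a ≤ b) :
    ∫ x in a..b, x ^ (r - 1) ≤ (-r)⁻¹ * a ^ r := by
  have h0 : (0:ℝ) ∉ Set.uIcc a b := by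
    rw [Set.uIcc_of_le hab]; exact fun h => absurd h.1 (not_le.2 ha)
  rw [integral_rpow (Or.inr ⟨by linarith, h0⟩), sub_add_cancel, ← neg_div_neg_eq, neg_sub,
    div_eq_inv_mul]
  have := Real.rpow_nonneg (ha.le.trans hab) r
  exact mul_le_mul_of_nonneg_left (by linarith) (inv_nonneg.2 (by linarith))

open Filter Topology in

/-- Comparison of `𝓕` and `J`: `|𝓕(λ) - J(λ)| ≤ C·(λ^{-α/4} + λ^{2-(3/2)α})`
on `(0,λ₀]`. -/
theorem F_J_comparison (α β₁ β₁' C₀ l₀ : ℝ)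
    (hα : α ∈ Set.Ioo (0:ℝ) 2) (hβ₁ : 0 < β₁) (hl₀ : l₀ ∈ Set.Ioo (0:ℝ) 1)
    (hg : ∀ μ ∈ Set.Ioc (0:ℝ) l₀, 0 < β₁' - 2 * β₁ / (2 - α) * Real.log μ)
    (hh : ∀ μ ∈ Set.Ioc (0:ℝ) l₀,
      0 < β₁' - 2 * β₁ / (2 - α) * Real.log μ + C₀ * μ ^ (2 - α))
    (J F : ℝ → ℝ)
    (hJ : ∀ l ∈ Set.Ioc (0:ℝ) l₀,
      J l = ∫ μ in l..l₀,
        μ ^ (-(α / 2 + 1)) * (β₁' - 2 * β₁ / (2 - α) * Real.log μ) ^ (-(1:ℝ) / 2))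
    (hF : ∀ l ∈ Set.Ioc (0:ℝ) l₀,
      F l = ∫ μ in l..l₀, μ ^ (-(α / 2 + 1)) *
        (β₁' - 2 * β₁ / (2 - α) * Real.log μ + C₀ * μ ^ (2 - α)) ^ (-(1:ℝ) / 2)) :
    ∃ C : ℝ, 0 < C ∧ ∀ l ∈ Set.Ioc (0:ℝ) l₀,
      |F l - J l| ≤ C * (l ^ (-(α / 4)) + l ^ (2 - 3 / 2 * α)) := by
  obtain ⟨hα0, hα2⟩ := hα
  set g : ℝ → ℝ := fun μ => β₁' - 2 * β₁ / (2 - α) * Real.log μ with hgdef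
  set h : ℝ → ℝ := fun μ => g μ + C₀ * μ ^ (2 - α) with hhdef
  have hpow : Continuous fun μ : ℝ => C₀ * μ ^ (2 - α) :=
    continuous_const.mul (Real.continuous_rpow_const (by linarith))
  have hne : ∀ μ ∈ Set.Ioc 0 l₀, μ ≠ 0 := fun μ hμ => hμ.1.ne'
  have hgc : ContinuousOn g (Set.Ioc 0 l₀) :=
    continuousOn_const.sub (continuousOn_const.mul (Real.continuousOn_log.mono hne))
  have hhc : ContinuousOn h (Set.Ioc 0 l₀) := hgc.add hpow.continuousOn
  have hglim : Tendsto g (𝓝[>] 0) atTop := by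
    have hc : 0 < 2 * β₁ / (2 - α) := div_pos (by linarith) (by linarith)
    have := tendsto_atTop_add_const_left _ β₁'
      (tendsto_neg_atBot_atTop.comp (Real.tendsto_log_nhdsGT_zero.const_mul_atBot hc))
    exact this.congr fun μ => (sub_eq_add_neg _ _).symm
  have hhlim : Tendsto h (𝓝[>] 0) atTop :=
    hglim.atTop_add ((hpow.tendsto 0).mono_left nhdsWithin_le_nhds)
  obtain ⟨m₁, hm₁, hgm⟩ := exists_pos_lower_bound_of_tendsto_atTop hgc hg hglim
  obtain ⟨m₂, hm₂, hhm⟩ := exists_pos_lower_bound_of_tendsto_atTop hhc hh hhlim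
  obtain ⟨m, hm, hmm₁, hmm₂⟩ : ∃ m, 0 < m ∧ m ≤ m₁ ∧ m ≤ m₂ :=
    ⟨min m₁ m₂, lt_min hm₁ hm₂, min_le_left _ _, min_le_right _ _⟩
  set r : ℝ := min (-(α / 4)) (2 - 3 / 2 * α) with hrdef
  have hr : r < 0 := (min_le_left _ _).trans_lt (by linarith)
  set K : ℝ := (m * √m)⁻¹ * |C₀| with hKdef
  have hK : 0 ≤ K := by positivity
  have hwc : ContinuousOn (fun μ : ℝ => μ ^ (-(α / 2 + 1))) (Set.Ioc 0 l₀) :=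
    continuousOn_id.rpow_const fun μ hμ => Or.inl (hne μ hμ)
  have hptwise : ∀ μ ∈ Set.Ioc 0 l₀,
      ‖μ ^ (-(α / 2 + 1)) * h μ ^ (-(1:ℝ) / 2) - μ ^ (-(α / 2 + 1)) * g μ ^ (-(1:ℝ) / 2)‖
        ≤ K * μ ^ (r - 1) := by
    intro μ hμ
    have hμ0 := hμ.1
    have hlip := abs_rpow_neg_half_sub_le hm (hmm₂.trans (hhm μ hμ)) (hmm₁.trans (hgm μ hμ))
    have hsub : |h μ - g μ| = |C₀| * μ ^ (2 - α) := by
      rw [hhdef, add_sub_cancel_left, abs_mul, abs_of_pos (Real.rpow_pos_of_pos hμ0 _)]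
    rw [← mul_sub, Real.norm_eq_abs, abs_mul, abs_of_pos (Real.rpow_pos_of_pos hμ0 _)]
    calc μ ^ (-(α / 2 + 1)) * |h μ ^ (-(1:ℝ) / 2) - g μ ^ (-(1:ℝ) / 2)|
        ≤ μ ^ (-(α / 2 + 1)) * ((m * √m)⁻¹ * (|C₀| * μ ^ (2 - α))) := by
          rw [← hsub]; gcongr
      _ = K * (μ ^ (-(α / 2 + 1)) * μ ^ (2 - α)) := by rw [hKdef]; ring
      _ = K * μ ^ (-(α / 2 + 1) + (2 - α)) := by rw [Real.rpow_add hμ0]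
      _ ≤ K * μ ^ (r - 1) := by
          have hr' : r ≤ 2 - 3 / 2 * α := min_le_right _ _
          exact mul_le_mul_of_nonneg_left (Real.rpow_le_rpow_of_exponent_ge hμ0
            (hμ.2.trans hl₀.2.le) (by linarith)) hK
  refine ⟨K * (-r)⁻¹ + 1, by have := inv_pos.2 (neg_pos.2 hr); positivity, fun l hl => ?_⟩
  have hsub : Set.uIcc l l₀ ⊆ Set.Ioc 0 l₀ := by
    rw [Set.uIcc_of_le hl.2]; exact fun μ hμ => ⟨hl.1.trans_le hμ.1, hμ.2⟩
  have hFi : IntervalIntegrable (fun μ => μ ^ (-(α / 2 + 1)) * h μ ^ (-(1:ℝ) / 2))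
      MeasureTheory.volume l l₀ :=
    ((hwc.mul (hhc.rpow_const fun μ hμ => Or.inl (hh μ hμ).ne')).mono hsub).intervalIntegrable
  have hJi : IntervalIntegrable (fun μ => μ ^ (-(α / 2 + 1)) * g μ ^ (-(1:ℝ) / 2))
      MeasureTheory.volume l l₀ :=
    ((hwc.mul (hgc.rpow_const fun μ hμ => Or.inl (hg μ hμ).ne')).mono hsub).intervalIntegrable
  have hbi : IntervalIntegrable (fun μ => K * μ ^ (r - 1)) MeasureTheory.volume l l₀ :=
    (continuousOn_const.mul (continuousOn_id.rpow_const
      fun μ hμ => Or.inl (hne μ (hsub hμ)))).intervalIntegrable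
  have hlr : l ^ r ≤ l ^ (-(α / 4)) + l ^ (2 - 3 / 2 * α) := by
    have h1 := Real.rpow_nonneg hl.1.le (-(α / 4))
    have h2 := Real.rpow_nonneg hl.1.le (2 - 3 / 2 * α)
    rcases min_choice (-(α / 4)) (2 - 3 / 2 * α) with h | h <;> rw [hrdef, h] <;> linarith
  have hlr0 := Real.rpow_nonneg hl.1.le r
  have hr0 : 0 ≤ (-r)⁻¹ := inv_nonneg.2 (by linarith)
  rw [hF l hl, hJ l hl, ← intervalIntegral.integral_sub hFi hJi, ← Real.norm_eq_abs]
  calc _ ≤ ∫ μ in l..l₀, K * μ ^ (r - 1) :=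
        intervalIntegral.norm_integral_le_of_norm_le hl.2
          (Eventually.of_forall fun μ hμ => hptwise μ ⟨hl.1.trans hμ.1, hμ.2⟩) hbi
    _ = K * ∫ μ in l..l₀, μ ^ (r - 1) := intervalIntegral.integral_const_mul _ _
    _ ≤ K * ((-r)⁻¹ * l ^ r) := by gcongr; exact integral_rpow_sub_one_le hr hl.1 hl.2
    _ ≤ (K * (-r)⁻¹ + 1) * l ^ r := by linarith
    _ ≤ _ := by gcongr
end

section
/- There exist constants C > 0 and s* > e such that for every s₁ ≥ s* and every λ₁ ∈ (0,λ₀) satisfying 𝓕(λ₁) = s₁: | J(λ₁)/s₁ − 1 | ≤ C·( s₁^{−1/2}·(log s₁)^{1/2} + s₁^{2−4/α}·(log s₁)^{1/2} ). -/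
open Real Set MeasureTheory

theorem rpow_neg_one_div_two_eq_inv_sqrt {x : ℝ} (hx : 0 ≤ x) :
    x ^ (-(1:ℝ) / 2) = (√x)⁻¹ := by
  rw [neg_div, Real.rpow_neg hx, Real.sqrt_eq_rpow]

theorem abs_inv_sqrt_sub_inv_sqrt_le {m x y : ℝ} (hm : 0 < m) (hx : m ≤ x) (hy : m ≤ y) :
    |(√x)⁻¹ - (√y)⁻¹| ≤ |y - x| / √m ^ 3 := by
  have hm' : 0 < √m := Real.sqrt_pos.2 hm
  have hx' : √m ≤ √x := Real.sqrt_le_sqrt hx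
  have hy' : √m ≤ √y := Real.sqrt_le_sqrt hy
  have hx0 : 0 < √x := hm'.trans_le hx'
  have hy0 : 0 < √y := hm'.trans_le hy'
  have hxx : √x ^ 2 = x := Real.sq_sqrt (hm.le.trans hx)
  have hyy : √y ^ 2 = y := Real.sq_sqrt (hm.le.trans hy)
  have key : (√x)⁻¹ - (√y)⁻¹ = (y - x) / (√x * √y * (√x + √y)) := by
    field_simp
    linear_combination hyy - hxx
  rw [key, abs_div, abs_of_pos (a := √x * √y * (√x + √y)) (by positivity)]
  gcongr
  calc √m ^ 3 = √m * √m * √m := by ring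
    _ ≤ √x * √y * (√x + √y) := by gcongr; linarith

theorem le_mul_sqrt_log_of_sub_le {C X₀ : ℝ} (hC : 0 < C) (hX₀ : 0 ≤ X₀) :
    ∃ K, 0 < K ∧ ∀ s X : ℝ, 3 ≤ s → 1 ≤ X → X - X₀ ≤ C * s * √(1 + log X) →
      X ≤ K * (s * √(log s)) := by
  set B := X₀ + C with hB
  have hB0 : 0 < B := by positivity
  set E := 1 + 2 * |log B| + 2 with hE
  have hE0 : 0 < E := by positivity
  refine ⟨X₀ + C * √E, by positivity, fun s X hs hX h => ?_⟩
  have hlogs : 1 ≤ log s := by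
    rw [Real.le_log_iff_exp_le (by linarith)]
    exact (Real.exp_one_lt_d9.le.trans (by norm_num)).trans hs
  have hX0 : 0 < X := by linarith
  have hsX : 1 ≤ √X := Real.one_le_sqrt.2 hX
  have crude : √X ≤ B * s := by
    have h1 : √(1 + log X) ≤ √X :=
      Real.sqrt_le_sqrt (by linarith [Real.log_le_sub_one_of_pos hX0])
    have h2 : C * s * √(1 + log X) ≤ C * s * √X := by gcongr
    have h3 : X₀ ≤ X₀ * s * √X := by
      have : 1 ≤ s * √X := by nlinarith
      nlinarith
    have h4 : √X * √X ≤ B * s * √X := by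
      rw [Real.mul_self_sqrt hX0.le, hB]; linarith
    exact le_of_mul_le_mul_right h4 (by linarith)
  have hlogX : log X ≤ 2 * (|log B| + log s) := by
    have h1 : log (√X) ≤ log (B * s) := Real.log_le_log (by linarith) crude
    rw [Real.log_sqrt hX0.le, Real.log_mul hB0.ne' (by linarith)] at h1
    linarith [le_abs_self (log B)]
  have hsq : √(1 + log X) ≤ √E * √(log s) := by
    rw [← Real.sqrt_mul hE0.le]
    apply Real.sqrt_le_sqrt
    rw [hE]
    nlinarith [abs_nonneg (log B)]
  have hls : 1 ≤ √(log s) := Real.one_le_sqrt.2 hlogs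
  have h1 : C * s * √(1 + log X) ≤ C * s * (√E * √(log s)) := by gcongr
  have h2 : X₀ ≤ X₀ * (s * √(log s)) := by
    have : 1 ≤ s * √(log s) := by nlinarith
    nlinarith
  linarith

theorem exists_pos_lower_bound_neg_log {a b c d l₀ : ℝ} (hb : 0 < b) (hd : 0 < d)
    (hg : 0 < a - b * log l₀) (hh : 0 < a - b * log l₀ + c * l₀ ^ d) :
    ∃ m, 0 < m ∧ ∀ μ ∈ Ioc (0:ℝ) l₀,
      m ≤ a - b * log μ ∧ m ≤ a - b * log μ + c * μ ^ d := by
  refine ⟨min (a - b * log l₀) (a - b * log l₀ + c * l₀ ^ d), lt_min hg hh, ?_⟩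
  rintro μ ⟨hμ, hμl⟩
  have hlog : a - b * log l₀ ≤ a - b * log μ := by
    have := Real.log_le_log hμ hμl
    gcongr
  refine ⟨(min_le_left _ _).trans hlog, ?_⟩
  rcases le_total 0 c with hc | hc
  · have : 0 ≤ c * μ ^ d := by positivity
    exact (min_le_left _ _).trans (by linarith)
  · have h1 : μ ^ d ≤ l₀ ^ d := by gcongr
    have := mul_le_mul_of_nonpos_left h1 hc
    exact (min_le_right _ _).trans (by linarith)

theorem integral_rpow_neg_sub_one {r l l₀ : ℝ} (hr : 0 < r) (hl : 0 < l) (hl₀ : 0 < l₀) :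
    ∫ μ in l..l₀, μ ^ (-(r + 1)) = (l ^ (-r) - l₀ ^ (-r)) / r := by
  have h0 : (0:ℝ) ∉ uIcc l l₀ := notMem_uIcc_of_lt hl hl₀
  rw [integral_rpow (Or.inr ⟨by linarith, h0⟩), show -(r + 1) + 1 = -r by ring]
  field_simp
  ring

theorem continuousOn_rpow_mul_inv_sqrt {f : ℝ → ℝ} {r : ℝ} {t : Set ℝ}
    (ht : ∀ μ ∈ t, 0 < μ) (hf : ContinuousOn f t) (hpos : ∀ μ ∈ t, 0 < f μ) :
    ContinuousOn (fun μ => μ ^ r * f μ ^ (-(1:ℝ) / 2)) t :=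
  (continuousOn_id.rpow_const fun μ hμ => Or.inl (ht μ hμ).ne').mul
    (hf.rpow_const fun μ hμ => Or.inl (hpos μ hμ).ne')


/-- If `𝓕(λ₁) = s₁` for large `s₁`, then
`|J(λ₁)/s₁ - 1| ≤ C·(s₁^{-1/2}(log s₁)^{1/2} + s₁^{2-4/α}(log s₁)^{1/2})`. -/
theorem J_over_s_estimate (α β₁ β₁' C₀ l₀ : ℝ)
    (hα : α ∈ Set.Ioo (0:ℝ) 2) (hβ₁ : 0 < β₁) (hl₀ : l₀ ∈ Set.Ioo (0:ℝ) 1)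
    (hg : ∀ μ ∈ Set.Ioc (0:ℝ) l₀, 0 < β₁' - 2 * β₁ / (2 - α) * Real.log μ)
    (hh : ∀ μ ∈ Set.Ioc (0:ℝ) l₀,
      0 < β₁' - 2 * β₁ / (2 - α) * Real.log μ + C₀ * μ ^ (2 - α))
    (J F : ℝ → ℝ)
    (hJ : ∀ l ∈ Set.Ioc (0:ℝ) l₀,
      J l = ∫ μ in l..l₀,
        μ ^ (-(α / 2 + 1)) * (β₁' - 2 * β₁ / (2 - α) * Real.log μ) ^ (-(1:ℝ) / 2))
    (hF : ∀ l ∈ Set.Ioc (0:ℝ) l₀,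
      F l = ∫ μ in l..l₀, μ ^ (-(α / 2 + 1)) *
        (β₁' - 2 * β₁ / (2 - α) * Real.log μ + C₀ * μ ^ (2 - α)) ^ (-(1:ℝ) / 2)) :
    ∃ C sstar : ℝ, 0 < C ∧ Real.exp 1 < sstar ∧
      ∀ s₁ : ℝ, sstar ≤ s₁ → ∀ l₁ ∈ Set.Ioo (0:ℝ) l₀, F l₁ = s₁ →
        |J l₁ / s₁ - 1| ≤
          C * (s₁ ^ (-(1:ℝ) / 2) * Real.log s₁ ^ ((1:ℝ) / 2) +
            s₁ ^ (2 - 4 / α) * Real.log s₁ ^ ((1:ℝ) / 2)) := by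
  obtain ⟨hα0, hα2⟩ := hα
  obtain ⟨hl0, hl1⟩ := hl₀
  have hd : 0 < 2 - α := by linarith
  set b := 2 * β₁ / (2 - α) with hb_def
  have hb : 0 < b := by positivity
  obtain ⟨m, hm, hmle⟩ := exists_pos_lower_bound_neg_log hb hd
    (hg l₀ ⟨hl0, le_rfl⟩) (hh l₀ ⟨hl0, le_rfl⟩)
  have hcontg : ContinuousOn (fun μ => β₁' - b * Real.log μ) (Ioc 0 l₀) :=
    continuousOn_const.sub
      (continuousOn_const.mul (Real.continuousOn_log.mono fun μ hμ => hμ.1.ne'))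
  have hconth : ContinuousOn (fun μ => β₁' - b * Real.log μ + C₀ * μ ^ (2 - α)) (Ioc 0 l₀) :=
    hcontg.add (continuousOn_const.mul
      (continuousOn_id.rpow_const fun μ hμ => Or.inl hμ.1.ne'))
  have hpos : ∀ μ ∈ Ioc (0:ℝ) l₀, 0 < μ := fun μ hμ => hμ.1
  have hsub : ∀ l ∈ Ioo (0:ℝ) l₀, uIcc l l₀ ⊆ Ioc 0 l₀ := fun l hl μ hμ => by
    rw [uIcc_of_le hl.2.le] at hμ
    exact ⟨hl.1.trans_le hμ.1, hμ.2⟩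
  have hintJ : ∀ l ∈ Ioo (0:ℝ) l₀, IntervalIntegrable (fun μ => μ ^ (-(α / 2 + 1)) *
      (β₁' - b * Real.log μ) ^ (-(1:ℝ) / 2)) volume l l₀ := fun l hl =>
    ((continuousOn_rpow_mul_inv_sqrt hpos hcontg hg).mono (hsub l hl)).intervalIntegrable
  have hintF : ∀ l ∈ Ioo (0:ℝ) l₀, IntervalIntegrable (fun μ => μ ^ (-(α / 2 + 1)) *
      (β₁' - b * Real.log μ + C₀ * μ ^ (2 - α)) ^ (-(1:ℝ) / 2)) volume l l₀ := fun l hl =>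
    ((continuousOn_rpow_mul_inv_sqrt hpos hconth hh).mono (hsub l hl)).intervalIntegrable
  have hintpow : ∀ l ∈ Ioo (0:ℝ) l₀, ∀ r : ℝ,
      IntervalIntegrable (fun μ : ℝ => μ ^ r) volume l l₀ := fun l hl r =>
    (continuousOn_id.rpow_const fun μ hμ =>
      Or.inl (hsub l hl hμ).1.ne').intervalIntegrable
  -- the lower bound for `F`
  set A := (|β₁'| + b + |C₀|) * (2 / α) with hA_def
  have hA : 0 < A := by positivity
  have hFlower : ∀ l ∈ Ioo (0:ℝ) l₀, l ^ (-(α / 2)) - l₀ ^ (-(α / 2)) ≤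
      (α / 2 * √A) * F l * √(1 + Real.log (l ^ (-(α / 2)))) := by
    intro l hl
    have hlog : Real.log (l ^ (-(α / 2))) = -(α / 2) * Real.log l := Real.log_rpow hl.1 _
    have hlogl : Real.log l < 0 := Real.log_neg hl.1 (hl.2.trans hl1)
    set L := 1 + Real.log (l ^ (-(α / 2))) with hL_def
    have hL : 0 < L := by rw [hL_def, hlog]; nlinarith
    have hsqrt : 0 < √(A * L) := Real.sqrt_pos.2 (by positivity)
    have hmono : ∫ μ in l..l₀, μ ^ (-(α / 2 + 1)) * (√(A * L))⁻¹ ≤ F l := by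
      rw [hF l ⟨hl.1, hl.2.le⟩]
      refine intervalIntegral.integral_mono_on hl.2.le
        ((hintpow l hl _).mul_const _) (hintF l hl) fun μ hμ => ?_
      have hμ0 : 0 < μ := hl.1.trans_le hμ.1
      have hhμ := hh μ ⟨hμ0, hμ.2⟩
      rw [rpow_neg_one_div_two_eq_inv_sqrt hhμ.le]
      have hs := Real.sqrt_pos.2 hhμ
      gcongr
      have h1 : C₀ * μ ^ (2 - α) ≤ |C₀| := by
        have h2 : μ ^ (2 - α) ≤ 1 :=
          Real.rpow_le_one hμ0.le (hμ.2.trans hl1.le) hd.le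
        have h3 : 0 ≤ μ ^ (2 - α) := by positivity
        calc C₀ * μ ^ (2 - α) ≤ |C₀| * μ ^ (2 - α) := by gcongr; exact le_abs_self _
          _ ≤ |C₀| * 1 := by gcongr
          _ = |C₀| := mul_one _
      have h2 : b * -Real.log μ ≤ b * -Real.log l := by
        have := Real.log_le_log hl.1 hμ.1
        gcongr
      have h3 : (2 / α) * L = 2 / α + -Real.log l := by
        rw [hL_def, hlog]; field_simp
      have h4 : 1 ≤ 2 / α := by rw [le_div_iff₀ hα0]; linarith
      rw [hA_def, mul_assoc, h3]
      nlinarith [le_abs_self β₁', abs_nonneg β₁', abs_nonneg C₀]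
    rw [intervalIntegral.integral_mul_const,
      integral_rpow_neg_sub_one (by positivity) hl.1 hl0, ← div_eq_mul_inv,
      div_le_iff₀ hsqrt, div_le_iff₀ (by positivity), Real.sqrt_mul hA.le] at hmono
    linarith
  -- the upper bound for `|J - F|`
  set p := max (1 / 2) (3 - 4 / α) with hp_def
  have hp0 : 0 < p := lt_of_lt_of_le (by norm_num) (le_max_left _ _)
  have hp1 : p ≤ 1 := by
    refine max_le (by norm_num) ?_
    have : 2 ≤ 4 / α := by rw [le_div_iff₀ hα0]; linarith
    linarith
  have hpα : 3 * α / 2 - 2 ≤ α / 2 * p := by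
    have h := mul_le_mul_of_nonneg_left (le_max_right (1 / 2) (3 - 4 / α)) hα0.le
    rw [← hp_def] at h
    have h' : α * (3 - 4 / α) = 3 * α - 4 := by field_simp
    linarith
  set M := |C₀| / √m ^ 3 with hM_def
  have hM : 0 ≤ M := by positivity
  set r := α / 2 * p with hr_def
  have hr : 0 < r := by positivity
  have hdiff : ∀ l ∈ Ioo (0:ℝ) l₀, |J l - F l| ≤ M / r * (l ^ (-(α / 2))) ^ p := by
    intro l hl
    rw [hJ l ⟨hl.1, hl.2.le⟩, hF l ⟨hl.1, hl.2.le⟩,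
      ← intervalIntegral.integral_sub (hintJ l hl) (hintF l hl), ← Real.norm_eq_abs]
    have hle : ‖∫ μ in l..l₀, (μ ^ (-(α / 2 + 1)) * (β₁' - b * Real.log μ) ^ (-(1:ℝ) / 2) -
        μ ^ (-(α / 2 + 1)) *
          (β₁' - b * Real.log μ + C₀ * μ ^ (2 - α)) ^ (-(1:ℝ) / 2))‖ ≤
        ∫ μ in l..l₀, M * μ ^ (-(r + 1)) := by
      refine intervalIntegral.norm_integral_le_of_norm_le hl.2.le
        (Filter.Eventually.of_forall fun μ hμ => ?_) ((hintpow l hl _).const_mul _)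
      have hμ0 : 0 < μ := hl.1.trans hμ.1
      have hμ' : μ ∈ Ioc 0 l₀ := ⟨hμ0, hμ.2⟩
      have hd' := abs_inv_sqrt_sub_inv_sqrt_le hm (hmle μ hμ').1 (hmle μ hμ').2
      rw [rpow_neg_one_div_two_eq_inv_sqrt (hg μ hμ').le,
        rpow_neg_one_div_two_eq_inv_sqrt (hh μ hμ').le, ← mul_sub, Real.norm_eq_abs, abs_mul,
        abs_of_pos (Real.rpow_pos_of_pos hμ0 _)]
      rw [add_sub_cancel_left, abs_mul, abs_of_pos (Real.rpow_pos_of_pos hμ0 (2 - α))] at hd'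
      calc _ ≤ μ ^ (-(α / 2 + 1)) * (|C₀| * μ ^ (2 - α) / √m ^ 3) := by gcongr
        _ = M * μ ^ (-(α / 2 + 1) + (2 - α)) := by
          rw [hM_def, Real.rpow_add hμ0]; ring
        _ ≤ M * μ ^ (-(r + 1)) := by
          refine mul_le_mul_of_nonneg_left ?_ hM
          exact Real.rpow_le_rpow_of_exponent_ge hμ0 (hμ.2.trans hl1.le) (by linarith)
    refine hle.trans ?_
    rw [intervalIntegral.integral_const_mul, integral_rpow_neg_sub_one hr hl.1 hl0,
      ← Real.rpow_mul hl.1.le, show -(α / 2) * p = -r by rw [hr_def]; ring,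
      show M / r * l ^ (-r) = M * (l ^ (-r) / r) by ring]
    have : 0 ≤ l₀ ^ (-r) := by positivity
    refine mul_le_mul_of_nonneg_left ?_ hM
    gcongr
    linarith
  obtain ⟨K, hK, hXle⟩ := le_mul_sqrt_log_of_sub_le (C := α / 2 * √A)
    (X₀ := l₀ ^ (-(α / 2))) (by positivity) (by positivity)
  refine ⟨M / r * K ^ p + 1, 3, by positivity, Real.exp_one_lt_d9.trans (by norm_num), ?_⟩
  intro s hs l hl hFs
  have hs0 : 0 < s := by linarith
  have hlogs : 1 ≤ Real.log s := by
    rw [Real.le_log_iff_exp_le hs0]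
    exact (Real.exp_one_lt_d9.le.trans (by norm_num)).trans hs
  have hX : l ^ (-(α / 2)) ≤ K * (s * √(Real.log s)) := by
    refine hXle s _ hs ?_ (hFs ▸ hFlower l hl)
    exact Real.one_le_rpow_of_pos_of_le_one_of_nonpos hl.1 (hl.2.trans hl1).le (by linarith)
  have hsq : 1 ≤ √(Real.log s) := Real.one_le_sqrt.2 hlogs
  have hlogp : √(Real.log s) ^ p ≤ √(Real.log s) := by
    simpa using Real.rpow_le_rpow_of_exponent_le hsq hp1
  have hsp : s ^ (p - 1) ≤ s ^ (-(1:ℝ) / 2) + s ^ (2 - 4 / α) := by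
    have h1 : 0 ≤ s ^ (-(1:ℝ) / 2) := by positivity
    have h2 : 0 ≤ s ^ (2 - 4 / α) := by positivity
    rcases max_choice (1 / 2) (3 - 4 / α) with h | h
    · rw [hp_def, h, show (1 / 2 - 1 : ℝ) = -1 / 2 by norm_num]; linarith
    · rw [hp_def, h, show 3 - 4 / α - 1 = 2 - 4 / α by ring]; linarith
  rw [← Real.sqrt_eq_rpow, ← add_mul]
  have hkey : |J l / s - 1| = |J l - F l| / s := by
    rw [hFs, ← abs_of_pos hs0, ← abs_div, abs_of_pos hs0, sub_div, div_self hs0.ne']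
  rw [hkey]
  have hMr : 0 ≤ M / r := by positivity
  have hl' : 0 ≤ l ^ (-(α / 2)) := Real.rpow_nonneg hl.1.le _
  calc |J l - F l| / s ≤ M / r * (K * (s * √(Real.log s))) ^ p / s := by
        gcongr
        refine (hdiff l hl).trans ?_
        gcongr
    _ = M / r * K ^ p * (s ^ (p - 1) * √(Real.log s) ^ p) := by
        rw [Real.mul_rpow hK.le (by positivity), Real.mul_rpow hs0.le (by positivity),
          Real.rpow_sub_one hs0.ne']
        ring
    _ ≤ (M / r * K ^ p + 1) *
        ((s ^ (-(1:ℝ) / 2) + s ^ (2 - 4 / α)) * √(Real.log s)) := by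
        gcongr
        linarith
end

section
/- There exist constants C > 0 and C' > 0 such that 𝓕(λ) ≤ C·λ^{−α/2} for every λ ∈ (0,λ₀]; consequently, for every s₁ ≥ 1 and every λ₁ ∈ (0,λ₀] with 𝓕(λ₁) = s₁, one has λ₁ ≤ C'·s₁^{−2/α}. -/
open Set Filter Topology in
/-- A continuous positive function on `(0, b]` that tends to `+∞` at `0` is bounded below by a
positive constant. -/
theorem exists_pos_lowerBound_of_tendsto_atTop {h : ℝ → ℝ} {b : ℝ}
    (hpos : ∀ x ∈ Ioc (0:ℝ) b, 0 < h x) (hcont : ContinuousOn h (Ioc 0 b))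
    (hlim : Tendsto h (𝓝[>] 0) atTop) : ∃ m > 0, ∀ x ∈ Ioc (0:ℝ) b, m ≤ h x := by
  obtain ⟨δ, hδ, hδh⟩ := mem_nhdsGT_iff_exists_Ioo_subset.mp (hlim.eventually_ge_atTop 1)
  have hδ0 : 0 < δ := hδ
  have hsub : Icc δ b ⊆ Ioc 0 b := fun x hx => ⟨hδ0.trans_le hx.1, hx.2⟩
  obtain ⟨m, hm, hmh⟩ := isCompact_Icc.exists_forall_le' (hcont.mono hsub)
    (fun x hx => hpos x (hsub hx))
  refine ⟨min 1 m, lt_min one_pos hm, fun x hx => ?_⟩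
  rcases lt_or_ge x δ with hxδ | hxδ
  · exact (min_le_left _ _).trans (hδh ⟨hx.1, hxδ⟩)
  · exact (min_le_right _ _).trans (hmh x ⟨hxδ, hx.2⟩)

open Set Filter Topology in
/-- `a - k * log x + c * x ^ p` tends to `+∞` as `x → 0⁺` when `k, p > 0`. -/
theorem tendsto_sub_mul_log_add_mul_rpow_atTop (a c : ℝ) {k p : ℝ} (hk : 0 < k) (hp : 0 < p) :
    Tendsto (fun x : ℝ => a - k * Real.log x + c * x ^ p) (𝓝[>] 0) atTop := by
  have hlog : Tendsto (fun x : ℝ => a - k * Real.log x) (𝓝[>] 0) atTop := by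
    have := tendsto_atTop_add_const_left (𝓝[>] (0:ℝ)) a
      (tendsto_neg_atBot_atTop.comp (Real.tendsto_log_nhdsGT_zero.const_mul_atBot hk))
    simpa [sub_eq_add_neg, Function.comp_def] using this
  have hpow : Tendsto (fun x : ℝ => c * x ^ p) (𝓝[>] 0) (𝓝 (c * 0 ^ p)) :=
    ((Real.continuousAt_rpow_const 0 p (Or.inr hp.le)).tendsto.const_mul c).mono_left
      nhdsWithin_le_nhds
  exact hlog.atTop_add hpow

open Set in
/-- If `m ≤ h` on `(0, b]`, the weighted integral of `h ^ (-1/2)` is controlled by the power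
weight. -/
theorem integral_rpow_mul_rpow_neg_half_le {h : ℝ → ℝ} {a b l m : ℝ} (ha : 0 < a) (hm : 0 < m)
    (hmh : ∀ x ∈ Ioc (0:ℝ) b, m ≤ h x) (hcont : ContinuousOn h (Ioc 0 b))
    (hl : l ∈ Ioc (0:ℝ) b) :
    ∫ x in l..b, x ^ (-(a + 1)) * h x ^ (-(1:ℝ) / 2) ≤ m ^ (-(1:ℝ) / 2) / a * l ^ (-a) := by
  have hsub : Icc l b ⊆ Ioc 0 b := fun x hx => ⟨hl.1.trans_le hx.1, hx.2⟩
  have hw : ContinuousOn (fun x : ℝ => x ^ (-(a + 1))) (Icc l b) :=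
    continuousOn_id.rpow_const fun x hx => Or.inl (hsub hx).1.ne'
  have hh : ContinuousOn (fun x : ℝ => h x ^ (-(1:ℝ) / 2)) (Icc l b) :=
    (hcont.mono hsub).rpow_const fun x hx => Or.inl (hm.trans_le (hmh x (hsub hx))).ne'
  have hzero : (0:ℝ) ∉ uIcc l b := by
    rw [uIcc_of_le hl.2]
    exact fun h0 => lt_irrefl _ (hsub h0).1
  calc ∫ x in l..b, x ^ (-(a + 1)) * h x ^ (-(1:ℝ) / 2)
      ≤ ∫ x in l..b, x ^ (-(a + 1)) * m ^ (-(1:ℝ) / 2) := by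
        refine intervalIntegral.integral_mono_on hl.2
          ((hw.mul hh).intervalIntegrable_of_Icc hl.2)
          ((hw.mul continuousOn_const).intervalIntegrable_of_Icc hl.2) fun x hx => ?_
        exact mul_le_mul_of_nonneg_left
          (Real.rpow_le_rpow_of_nonpos hm (hmh x (hsub hx)) (by norm_num))
          (Real.rpow_nonneg (hsub hx).1.le _)
    _ = m ^ (-(1:ℝ) / 2) / a * (l ^ (-a) - b ^ (-a)) := by
        rw [intervalIntegral.integral_mul_const,
          integral_rpow (Or.inr ⟨by linarith, hzero⟩), show -(a + 1) + 1 = -a by ring]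
        field_simp
        ring
    _ ≤ m ^ (-(1:ℝ) / 2) / a * l ^ (-a) := by
        have hb := Real.rpow_nonneg (hl.1.le.trans hl.2) (-a)
        exact mul_le_mul_of_nonneg_left (by linarith) (by positivity)

/-- Inverting an upper bound by a negative power. -/
theorem le_rpow_mul_rpow_of_le_mul_rpow_neg {a C s l : ℝ} (ha : 0 < a) (hC : 0 < C) (hs : 0 < s)
    (hl : 0 < l) (h : s ≤ C * l ^ (-a)) : l ≤ C ^ a⁻¹ * s ^ (-a⁻¹) := by
  have hla : 0 < l ^ a := Real.rpow_pos_of_pos hl a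
  have hle : l ^ a ≤ C / s := by
    rw [Real.rpow_neg hl.le, ← div_eq_mul_inv, le_div_iff₀ hla] at h
    rw [le_div_iff₀ hs]
    linarith
  calc l = (l ^ a) ^ a⁻¹ := (Real.rpow_rpow_inv hl.le ha.ne').symm
    _ ≤ (C / s) ^ a⁻¹ := Real.rpow_le_rpow hla.le hle (inv_nonneg.mpr ha.le)
    _ = C ^ a⁻¹ * s ^ (-a⁻¹) := by
      rw [Real.div_rpow hC.le hs.le, Real.rpow_neg hs.le, div_eq_mul_inv]

/-- Bound `𝓕(λ) ≤ C·λ^{-α/2}` on `(0,λ₀]`; consequently `𝓕(λ₁) = s₁ ≥ 1` forces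
`λ₁ ≤ C'·s₁^{-2/α}`. -/
theorem F_upper_bound (α β₁ β₁' C₀ l₀ : ℝ)
    (hα : α ∈ Set.Ioo (0:ℝ) 2) (hβ₁ : 0 < β₁) (hl₀ : l₀ ∈ Set.Ioo (0:ℝ) 1)
    (hh : ∀ μ ∈ Set.Ioc (0:ℝ) l₀,
      0 < β₁' - 2 * β₁ / (2 - α) * Real.log μ + C₀ * μ ^ (2 - α))
    (F : ℝ → ℝ)
    (hF : ∀ l ∈ Set.Ioc (0:ℝ) l₀,
      F l = ∫ μ in l..l₀, μ ^ (-(α / 2 + 1)) *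
        (β₁' - 2 * β₁ / (2 - α) * Real.log μ + C₀ * μ ^ (2 - α)) ^ (-(1:ℝ) / 2)) :
    ∃ C C' : ℝ, 0 < C ∧ 0 < C' ∧
      (∀ l ∈ Set.Ioc (0:ℝ) l₀, F l ≤ C * l ^ (-(α / 2))) ∧
      ∀ s₁ : ℝ, 1 ≤ s₁ → ∀ l₁ ∈ Set.Ioc (0:ℝ) l₀, F l₁ = s₁ →
        l₁ ≤ C' * s₁ ^ (-(2 / α)) := by
  obtain ⟨hα0, hα2⟩ := hα
  have ha : 0 < α / 2 := by linarith
  have hp : 0 < 2 - α := by linarith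
  have hcont : ContinuousOn
      (fun μ : ℝ => β₁' - 2 * β₁ / (2 - α) * Real.log μ + C₀ * μ ^ (2 - α)) (Set.Ioc 0 l₀) := by
    have hlog : ContinuousOn Real.log (Set.Ioc 0 l₀) :=
      Real.continuousOn_log.mono fun x hx => hx.1.ne'
    have hpow : ContinuousOn (fun μ : ℝ => μ ^ (2 - α)) (Set.Ioc 0 l₀) :=
      continuousOn_id.rpow_const fun x hx => Or.inr hp.le
    exact (continuousOn_const.sub (continuousOn_const.mul hlog)).add
      (continuousOn_const.mul hpow)
  obtain ⟨m, hm, hmh⟩ := exists_pos_lowerBound_of_tendsto_atTop hh hcont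
    (tendsto_sub_mul_log_add_mul_rpow_atTop β₁' C₀ (by positivity) hp)
  have hC : 0 < m ^ (-(1:ℝ) / 2) / (α / 2) := by positivity
  have hbound : ∀ l ∈ Set.Ioc (0:ℝ) l₀,
      F l ≤ m ^ (-(1:ℝ) / 2) / (α / 2) * l ^ (-(α / 2)) := fun l hl =>
    (hF l hl).trans_le (integral_rpow_mul_rpow_neg_half_le ha hm hmh hcont hl)
  refine ⟨_, _, hC, Real.rpow_pos_of_pos hC (α / 2)⁻¹, hbound, fun s₁ hs₁ l₁ hl₁ hFs => ?_⟩
  rw [← inv_div α 2]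
  exact le_rpow_mul_rpow_of_le_mul_rpow_neg ha hC (by linarith) hl₁.1 (hFs ▸ hbound l₁ hl₁)
end

section
/- There exist constants c₁, c₂ > 0 and s* > e such that: for all s ≥ s* and all λ ∈ (0,λ₀] satisfying |J(λ) − s| ≤ s·(log s)^{−1/2}, one has c₁·s^{−2} ≤ λ^α·|log λ| ≤ c₂·s^{−2}. Moreover, if λ_app(s) ∈ (0,λ₀) is determined by J(λ_app(s)) = s and b_app(s) := λ_app(s)^{α/2}·√(β₁' − (2β₁/(2−α))·log λ_app(s)), then there are constants c₃, c₄ > 0 such that any real b > 0 with |b/b_app(s) − 1| ≤ (log s)^{−1/2} satisfies c₃·s^{−1} ≤ b ≤ c₄·s^{−1}. -/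
namespace BlowupLaw

open Set intervalIntegral

/-- The integrand of the inverse blow-up law, with `g μ = B - K log μ`. -/
noncomputable def density (a B K μ : ℝ) : ℝ :=
  μ ^ (-(a / 2 + 1)) * (B - K * Real.log μ) ^ (-(1 : ℝ) / 2)

/-- The leading-order profile of the integral of `density`. -/
noncomputable def profile (a B K μ : ℝ) : ℝ :=
  μ ^ (-(a / 2)) * (B - K * Real.log μ) ^ (-(1 : ℝ) / 2)

variable {a B K : ℝ}

lemma density_pos {μ : ℝ} (hμ : 0 < μ) (hg : 0 < B - K * Real.log μ) :
    0 < density a B K μ :=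
  mul_pos (Real.rpow_pos_of_pos hμ _) (Real.rpow_pos_of_pos hg _)

lemma profile_pos {μ : ℝ} (hμ : 0 < μ) (hg : 0 < B - K * Real.log μ) :
    0 < profile a B K μ :=
  mul_pos (Real.rpow_pos_of_pos hμ _) (Real.rpow_pos_of_pos hg _)

lemma hasDerivAt_profile {μ : ℝ} (hμ : 0 < μ) (hg : 0 < B - K * Real.log μ) :
    HasDerivAt (profile a B K)
      (-(density a B K μ * (a / 2 - K / (2 * (B - K * Real.log μ))))) μ := by
  have h₁ : HasDerivAt (fun x : ℝ => B - K * Real.log x) (-(K * μ⁻¹)) μ := by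
    simpa using ((Real.hasDerivAt_log hμ.ne').const_mul K).const_sub B
  have h₂ := h₁.rpow_const (p := -(1 : ℝ) / 2) (Or.inl hg.ne')
  have h₃ := Real.hasDerivAt_rpow_const (p := -(a / 2)) (Or.inl hμ.ne')
  refine (h₃.mul h₂).congr_deriv ?_
  have e : μ ^ (-(a / 2)) = μ ^ (-(a / 2 + 1)) * μ := by
    rw [← Real.rpow_add_one hμ.ne']; congr 1; ring
  have e' : -(a / 2) - 1 = -(a / 2 + 1) := by ring
  rw [Real.rpow_sub_one hg.ne', e, e', density]
  field_simp
  ring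

lemma continuousOn_density {s : Set ℝ} (hs : ∀ μ ∈ s, 0 < μ ∧ 0 < B - K * Real.log μ) :
    ContinuousOn (density a B K) s := fun μ hμ => by
  obtain ⟨h0, hg⟩ := hs μ hμ
  refine ContinuousAt.continuousWithinAt ?_
  have hlog := Real.continuousAt_log h0.ne'
  exact (continuousAt_id.rpow_const (Or.inl h0.ne')).mul
    ((continuousAt_const.sub (continuousAt_const.mul hlog)).rpow_const (Or.inl hg.ne'))

lemma continuousOn_density_mul {s : Set ℝ}
    (hs : ∀ μ ∈ s, 0 < μ ∧ 0 < B - K * Real.log μ) :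
    ContinuousOn (fun μ => density a B K μ * (a / 2 - K / (2 * (B - K * Real.log μ)))) s := by
  refine (continuousOn_density hs).mul (continuousOn_const.sub (continuousOn_const.div
    (continuousOn_const.mul (continuousOn_const.sub (continuousOn_const.mul
      (Real.continuousOn_log.mono fun μ hμ => (hs μ hμ).1.ne')))) fun μ hμ => ?_))
  have := (hs μ hμ).2
  positivity

/-- Fundamental theorem of calculus for `profile`. -/
lemma integral_density_mul {l r : ℝ} (hlr : l ≤ r)
    (hs : ∀ μ ∈ Icc l r, 0 < μ ∧ 0 < B - K * Real.log μ) :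
    ∫ μ in l..r, density a B K μ * (a / 2 - K / (2 * (B - K * Real.log μ))) =
      profile a B K l - profile a B K r := by
  rw [← uIcc_of_le hlr] at hs
  have h := integral_eq_sub_of_hasDerivAt
    (fun μ hμ => (hasDerivAt_profile (a := a) (hs μ hμ).1 (hs μ hμ).2).neg)
    (by simpa using (continuousOn_density_mul hs).intervalIntegrable)
  simp only [neg_neg, Pi.neg_apply] at h
  rw [h]; ring

lemma profile_sub_le {l r : ℝ} (hK : 0 ≤ K) (hlr : l ≤ r)
    (hs : ∀ μ ∈ Icc l r, 0 < μ ∧ 0 < B - K * Real.log μ) :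
    profile a B K l - profile a B K r ≤ a / 2 * ∫ μ in l..r, density a B K μ := by
  rw [← integral_density_mul hlr hs, ← integral_const_mul]
  have hs' := hs
  rw [← uIcc_of_le hlr] at hs'
  refine integral_mono_on hlr (continuousOn_density_mul hs').intervalIntegrable
    (continuousOn_const.mul (continuousOn_density hs')).intervalIntegrable fun μ hμ => ?_
  obtain ⟨h0, hg⟩ := hs μ hμ
  have hd := density_pos (a := a) h0 hg
  have : 0 ≤ K / (2 * (B - K * Real.log μ)) := by positivity
  nlinarith

lemma le_profile_sub {l r : ℝ} (ha : 0 < a) (hlr : l ≤ r)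
    (hs : ∀ μ ∈ Icc l r, 0 < μ ∧ 0 < B - K * Real.log μ)
    (hK : ∀ μ ∈ Icc l r, 2 * K / a ≤ B - K * Real.log μ) :
    a / 4 * ∫ μ in l..r, density a B K μ ≤ profile a B K l - profile a B K r := by
  rw [← integral_density_mul hlr hs, ← integral_const_mul]
  have hs' := hs
  rw [← uIcc_of_le hlr] at hs'
  refine integral_mono_on hlr (continuousOn_const.mul (continuousOn_density hs')).intervalIntegrable
    (continuousOn_density_mul hs').intervalIntegrable fun μ hμ => ?_
  obtain ⟨h0, hg⟩ := hs μ hμ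
  have hd := density_pos (a := a) h0 hg
  have : K / (2 * (B - K * Real.log μ)) ≤ a / 4 := by
    have h := hK μ hμ
    rw [div_le_iff₀ ha] at h
    rw [div_le_iff₀ (by positivity)]
    linarith
  nlinarith

/-- The integral of `density` is at most a multiple of `profile`, up to an additive constant. -/
lemma exists_integral_le_profile {r : ℝ} (ha : 0 < a) (hK : 0 < K) (hr : 0 < r)
    (hg : ∀ μ ∈ Ioc 0 r, 0 < B - K * Real.log μ) :
    ∃ D, ∀ l ∈ Ioc 0 r, a / 4 * ∫ μ in l..r, density a B K μ ≤ D + profile a B K l := by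
  set ε := min r (Real.exp ((B - 2 * K / a) / K))
  have hε : 0 < ε := lt_min hr (Real.exp_pos _)
  have hεr : ε ≤ r := min_le_left _ _
  have hint : ∀ x y, 0 < x → x ≤ y → y ≤ r →
      IntervalIntegrable (density a B K) MeasureTheory.volume x y := fun x y hx hxy hy => by
    refine (continuousOn_density fun μ hμ => ?_).intervalIntegrable
    rw [uIcc_of_le hxy] at hμ
    have : 0 < μ := hx.trans_le hμ.1
    exact ⟨this, hg μ ⟨this, hμ.2.trans hy⟩⟩
  have hnn : ∀ x y, 0 < x → x ≤ y → y ≤ r → 0 ≤ ∫ μ in x..y, density a B K μ :=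
    fun x y hx hxy hy => integral_nonneg hxy fun μ hμ =>
      (density_pos (hx.trans_le hμ.1) (hg μ ⟨hx.trans_le hμ.1, hμ.2.trans hy⟩)).le
  refine ⟨a / 4 * ∫ μ in ε..r, density a B K μ, fun l ⟨hl, hlr⟩ => ?_⟩
  have hp := profile_pos (a := a) hl (hg l ⟨hl, hlr⟩)
  rcases le_total l ε with h | h
  · rw [← integral_add_adjacent_intervals (hint l ε hl h hεr) (hint ε r hε hεr le_rfl), mul_add]
    have hpε := profile_pos (a := a) hε (hg ε ⟨hε, hεr⟩)
    have hs : ∀ μ ∈ Icc l ε, 0 < μ ∧ 0 < B - K * Real.log μ := fun μ hμ =>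
      ⟨hl.trans_le hμ.1, hg μ ⟨hl.trans_le hμ.1, hμ.2.trans hεr⟩⟩
    have := le_profile_sub ha h hs fun μ hμ => by
      have : Real.log μ ≤ (B - 2 * K / a) / K :=
        (Real.log_le_iff_le_exp (hs μ hμ).1).2 (hμ.2.trans (min_le_right _ _))
      rw [le_div_iff₀ hK] at this
      linarith
    linarith
  · rw [← integral_add_adjacent_intervals (hint ε l hε h hlr) (hint l r hl hlr le_rfl)]
    have := mul_nonneg ha.le (hnn ε l hε h hlr)
    linarith

/-- Where the integral of `density` is comparable to a large `s`, so is `profile`. -/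
lemma exists_profile_bounds {r : ℝ} (ha : 0 < a) (hK : 0 < K) (hr : 0 < r)
    (hg : ∀ μ ∈ Ioc 0 r, 0 < B - K * Real.log μ) :
    ∃ s₀, ∀ s, s₀ ≤ s → ∀ l ∈ Ioc 0 r, |(∫ μ in l..r, density a B K μ) - s| ≤ s / 2 →
      a / 16 * s ≤ profile a B K l ∧ profile a B K l ≤ (a + 1) * s := by
  obtain ⟨D, hD⟩ := exists_integral_le_profile ha hK hr hg
  refine ⟨max (max (16 * D / a) 0) (profile a B K r), fun s hs l hl hJ => ?_⟩
  have h₁ : 16 * D / a ≤ s := (le_max_left _ _).trans ((le_max_left _ _).trans hs)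
  have h₀ : 0 ≤ s := (le_max_right _ _).trans ((le_max_left _ _).trans hs)
  have h₂ : profile a B K r ≤ s := (le_max_right _ _).trans hs
  rw [div_le_iff₀ ha] at h₁
  have hDl := hD l hl
  have hp := profile_sub_le (a := a) hK.le hl.2 fun μ hμ =>
    ⟨hl.1.trans_le hμ.1, hg μ ⟨hl.1.trans_le hμ.1, hμ.2⟩⟩
  obtain ⟨hJ₁, hJ₂⟩ := abs_le.1 hJ
  constructor <;> nlinarith

lemma inv_profile {μ : ℝ} (hμ : 0 < μ) (hg : 0 < B - K * Real.log μ) :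
    (profile a B K μ)⁻¹ = μ ^ (a / 2) * √(B - K * Real.log μ) := by
  rw [profile, mul_inv, ← Real.rpow_neg hμ.le, ← Real.rpow_neg hg.le, Real.sqrt_eq_rpow]
  norm_num [neg_div]

lemma inv_profile_sq {μ : ℝ} (hμ : 0 < μ) (hg : 0 < B - K * Real.log μ) :
    ((profile a B K μ)⁻¹) ^ 2 = μ ^ a * (B - K * Real.log μ) := by
  rw [inv_profile hμ hg, mul_pow, Real.sq_sqrt hg.le, ← Real.rpow_natCast, ← Real.rpow_mul hμ.le]
  norm_num

/-- An affine function of `log` positive at `r < 1` is comparable to `|log|` on `(0, r]`. -/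
lemma exists_abs_log_bounds {r : ℝ} (hK : 0 < K) (hr : r ∈ Ioo (0 : ℝ) 1)
    (hg : 0 < B - K * Real.log r) :
    ∃ m M, 0 < m ∧ 0 < M ∧ ∀ l ∈ Ioc 0 r,
      m * |Real.log l| ≤ B - K * Real.log l ∧ B - K * Real.log l ≤ M * |Real.log l| := by
  have hL : 0 < -Real.log r := neg_pos.2 (Real.log_neg hr.1 hr.2)
  set q := (B - K * Real.log r) / -Real.log r
  have hq : 0 < q := div_pos hg hL
  have hqL : q * -Real.log r = B - K * Real.log r := div_mul_cancel₀ _ hL.ne'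
  refine ⟨min K q, max K q, lt_min hK hq, lt_max_of_lt_left hK, fun l hl => ?_⟩
  have hlog : Real.log l ≤ Real.log r := Real.log_le_log hl.1 hl.2
  rw [abs_of_neg (by linarith)]
  have h₁ := min_le_left K q
  have h₂ := min_le_right K q
  have h₃ := le_max_left K q
  have h₄ := le_max_right K q
  constructor <;> nlinarith

lemma rpow_neg_half_le_half {x : ℝ} (hx : 4 ≤ x) : x ^ (-(1 : ℝ) / 2) ≤ 1 / 2 := by
  rw [neg_div, Real.rpow_neg (by linarith), ← Real.sqrt_eq_rpow, ← one_div]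
  exact one_div_le_one_div_of_le two_pos (Real.le_sqrt_of_sq_le (by linarith))

end BlowupLaw

/-- Bootstrap consequence: if `|J(λ) - s| ≤ s(log s)^{-1/2}` then
`λ^α|log λ| ≈ s^{-2}`; and any `b > 0` with `|b/b_app(s) - 1| ≤ (log s)^{-1/2}`
satisfies `b ≈ s^{-1}`. -/
theorem bootstrap_lambda_b_bounds (α β₁ β₁' l₀ : ℝ)
    (hα : α ∈ Set.Ioo (0:ℝ) 2) (hβ₁ : 0 < β₁) (hl₀ : l₀ ∈ Set.Ioo (0:ℝ) 1)
    (hg : ∀ μ ∈ Set.Ioc (0:ℝ) l₀, 0 < β₁' - 2 * β₁ / (2 - α) * Real.log μ)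
    (J : ℝ → ℝ)
    (hJ : ∀ l ∈ Set.Ioc (0:ℝ) l₀,
      J l = ∫ μ in l..l₀,
        μ ^ (-(α / 2 + 1)) * (β₁' - 2 * β₁ / (2 - α) * Real.log μ) ^ (-(1:ℝ) / 2)) :
    ∃ c₁ c₂ c₃ c₄ sstar : ℝ, 0 < c₁ ∧ 0 < c₂ ∧ 0 < c₃ ∧ 0 < c₄ ∧ Real.exp 1 < sstar ∧
      (∀ s : ℝ, sstar ≤ s → ∀ l ∈ Set.Ioc (0:ℝ) l₀,
        |J l - s| ≤ s * Real.log s ^ (-(1:ℝ) / 2) →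
          c₁ * s ^ (-2 : ℝ) ≤ l ^ α * |Real.log l| ∧
          l ^ α * |Real.log l| ≤ c₂ * s ^ (-2 : ℝ)) ∧
      (∀ s : ℝ, sstar ≤ s → ∀ lapps ∈ Set.Ioo (0:ℝ) l₀, J lapps = s →
        ∀ b : ℝ, 0 < b →
          |b / (lapps ^ (α / 2) *
              Real.sqrt (β₁' - 2 * β₁ / (2 - α) * Real.log lapps)) - 1| ≤
            Real.log s ^ (-(1:ℝ) / 2) →
          c₃ * s ^ (-1 : ℝ) ≤ b ∧ b ≤ c₄ * s ^ (-1 : ℝ)) := by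
  obtain ⟨hα₀, hα₂⟩ := hα
  have hK : 0 < 2 * β₁ / (2 - α) := div_pos (by linarith) (by linarith)
  generalize 2 * β₁ / (2 - α) = K at *
  obtain ⟨s₀, hs₀⟩ := BlowupLaw.exists_profile_bounds hα₀ hK hl₀.1 hg
  obtain ⟨m, M, hm, hM, hmM⟩ :=
    BlowupLaw.exists_abs_log_bounds hK hl₀ (hg l₀ ⟨hl₀.1, le_rfl⟩)
  have key : ∀ s, max (Real.exp 4) s₀ ≤ s → 0 < s ∧ Real.log s ^ (-(1 : ℝ) / 2) ≤ 1 / 2 ∧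
      ∀ l ∈ Set.Ioc 0 l₀, |J l - s| ≤ s / 2 →
        (α + 1)⁻¹ * s⁻¹ ≤ (BlowupLaw.profile α β₁' K l)⁻¹ ∧
        (BlowupLaw.profile α β₁' K l)⁻¹ ≤ 16 / α * s⁻¹ := by
    intro s hs
    have hs4 := (le_max_left _ _).trans hs
    have hs0 : 0 < s := (Real.exp_pos _).trans_le hs4
    refine ⟨hs0, BlowupLaw.rpow_neg_half_le_half ((Real.le_log_iff_exp_le hs0).2 hs4),
      fun l hl hJl => ?_⟩
    rw [hJ l hl] at hJl
    obtain ⟨h₁, h₂⟩ := hs₀ s ((le_max_right _ _).trans hs) l hl hJl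
    have hp := BlowupLaw.profile_pos (a := α) hl.1 (hg l hl)
    rw [← mul_inv, ← inv_div, ← mul_inv]
    exact ⟨inv_anti₀ hp h₂, inv_anti₀ (by positivity) h₁⟩
  refine ⟨((α + 1)⁻¹) ^ 2 / M, (16 / α) ^ 2 / m, (α + 1)⁻¹ / 2, 3 / 2 * (16 / α),
    max (Real.exp 4) s₀, by positivity, by positivity, by positivity, by positivity,
    lt_max_of_lt_left (Real.exp_lt_exp.2 (by norm_num)), fun s hs l hl hJl => ?_,
    fun s hs l hl hJl b hb hbl => ?_⟩
  · obtain ⟨hs0, hlog, hk⟩ := key s hs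
    obtain ⟨h₁, h₂⟩ := hk l hl (hJl.trans (by nlinarith))
    have hsq := BlowupLaw.inv_profile_sq (a := α) hl.1 (hg l hl)
    have hla := Real.rpow_pos_of_pos hl.1 α
    obtain ⟨hm₁, hM₁⟩ := hmM l hl
    have e₁ := pow_le_pow_left₀ (by positivity) h₁ 2
    have e₂ := pow_le_pow_left₀ (inv_nonneg.2 (BlowupLaw.profile_pos hl.1 (hg l hl)).le) h₂ 2
    rw [hsq, mul_pow] at e₁ e₂
    have hs2 : s ^ (-2 : ℝ) = s⁻¹ ^ 2 := by
      rw [Real.rpow_neg hs0.le, inv_pow]; norm_num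
    rw [hs2, div_mul_eq_mul_div, div_mul_eq_mul_div, div_le_iff₀ hM, le_div_iff₀ hm]
    constructor <;> nlinarith
  · obtain ⟨hs0, hlog, hk⟩ := key s hs
    have hl' : l ∈ Set.Ioc 0 l₀ := ⟨hl.1, hl.2.le⟩
    obtain ⟨h₁, h₂⟩ := hk l hl' (by rw [hJl, sub_self, abs_zero]; positivity)
    have hp := BlowupLaw.profile_pos (a := α) hl.1 (hg l hl')
    rw [← BlowupLaw.inv_profile hl.1 (hg l hl'), div_inv_eq_mul] at hbl
    obtain ⟨h₃, h₄⟩ := abs_le.1 (hbl.trans hlog)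
    have e₁ : 1 / 2 * (BlowupLaw.profile α β₁' K l)⁻¹ ≤ b := by
      rw [← div_eq_mul_inv, div_le_iff₀ hp]; linarith
    have e₂ : b ≤ 3 / 2 * (BlowupLaw.profile α β₁' K l)⁻¹ := by
      rw [← div_eq_mul_inv, le_div_iff₀ hp]; linarith
    rw [Real.rpow_neg_one]
    constructor <;> linarith
end

section
/- Let K ≥ 2, A, a₁, a₂, a₃, a₄ > 0, let s* ≥ e and s₁ ≥ s*, let λ : [s*,s₁] → (0,λ₀) be differentiable and b : [s*,s₁] → (0,∞) be such that for all s ∈ [s*,s₁]: |λ'(s)/λ(s) + b(s)| ≤ s^{−(K+1)}, |b(s)² − λ(s)^α·h(λ(s))| ≤ A·s^{−4}, a₁·s^{−1} ≤ b(s) ≤ a₂·s^{−1}, and a₃·s^{−2} ≤ λ(s)^α·|log λ(s)| ≤ a₄·s^{−2}. Then there exist C > 0 and s** > 0, depending only on α, β₁, β₁', C₀, λ₀, K, A, a₁, a₂, a₃, a₄, such that | (d/ds) 𝓕(λ(s)) − 1 | ≤ C·s^{−2} for all s ∈ [max(s*,s**), s₁]. -/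
open MeasureTheory Set in
/-- A primitive `l ↦ ∫ μ in l..c, f μ` of a function continuous on `(a, c]` has derivative `-f`
in the interior. -/
theorem hasDerivAt_of_eq_integral_left {f F : ℝ → ℝ} {a c l : ℝ}
    (hf : ContinuousOn f (Ioc a c)) (hF : ∀ x ∈ Ioc a c, F x = ∫ μ in x..c, f μ)
    (hl : l ∈ Ioo a c) : HasDerivAt F (-f l) l := by
  have hnhds : Ioo a c ∈ nhds l := Ioo_mem_nhds hl.1 hl.2
  have hfo : ContinuousOn f (Ioo a c) := hf.mono Ioo_subset_Ioc_self
  have hint : IntervalIntegrable f volume l c := by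
    refine ContinuousOn.intervalIntegrable (hf.mono ?_)
    rw [uIcc_of_le hl.2.le]
    exact fun x hx => ⟨hl.1.trans_le hx.1, hx.2⟩
  have hderiv := intervalIntegral.integral_hasDerivAt_left hint
    (hfo.stronglyMeasurableAtFilter isOpen_Ioo l hl) (hfo.continuousAt hnhds)
  refine hderiv.congr_of_eventuallyEq ?_
  filter_upwards [hnhds] with x hx using hF x (Ioo_subset_Ioc_self hx)

/-- If `b ≳ u`, `b² = g² + O(u⁴)` and `v = b + O(u³)`, then `v / g = 1 + O(u²)` for small `u`. -/
theorem abs_div_sub_one_le_of_sq_close {A a u b g v : ℝ} (hA : 0 < A) (ha : 0 < a) (hu : 0 < u)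
    (hg : 0 < g) (hb : a * u ≤ b) (hsq : |b ^ 2 - g ^ 2| ≤ A * u ^ 4) (hv : |v - b| ≤ u ^ 3)
    (hsmall : 2 * A * u ^ 2 ≤ a ^ 2) :
    |v / g - 1| ≤ 2 * (A / a + 1) / a * u ^ 2 := by
  have hau : 0 < a * u := mul_pos ha hu
  have hg_lower : a * u / 2 ≤ g := by
    refine le_of_sq_le_sq ?_ hg.le
    have h₁ : (a * u) ^ 2 ≤ b ^ 2 := pow_le_pow_left₀ hau.le hb 2
    have h₂ := (abs_le.mp hsq).2
    have h₃ := mul_le_mul_of_nonneg_right hsmall (sq_nonneg u)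
    nlinarith [sq_nonneg (a * u)]
  have hbg : |b - g| ≤ A / a * u ^ 3 := by
    have hprod : |b - g| * (b + g) ≤ A * u ^ 4 := by
      rwa [← abs_of_pos (show 0 < b + g by linarith), ← abs_mul,
        show (b - g) * (b + g) = b ^ 2 - g ^ 2 by ring]
    have hle : |b - g| * (a * u) ≤ A * u ^ 4 :=
      (mul_le_mul_of_nonneg_left (by linarith) (abs_nonneg _)).trans hprod
    rw [← le_div_iff₀ hau] at hle
    exact hle.trans_eq (by field_simp)
  have hvg : |v - g| ≤ (A / a + 1) * u ^ 3 := by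
    have := abs_sub_le v b g
    linarith
  rw [div_sub_one hg.ne', abs_div, abs_of_pos hg, div_le_iff₀ hg]
  calc |v - g| ≤ (A / a + 1) * u ^ 3 := hvg
    _ = 2 * (A / a + 1) / a * u ^ 2 * (a * u / 2) := by field_simp
    _ ≤ 2 * (A / a + 1) / a * u ^ 2 * g := by gcongr


/-- Under the bootstrap modulation estimates, `|(d/ds) 𝓕(λ(s)) - 1| ≤ C·s^{-2}`,
with `C` and `s**` depending only on the fixed data. -/
theorem F_deriv_along_flow (α β₁ β₁' C₀ l₀ : ℝ)
    (hα : α ∈ Set.Ioo (0:ℝ) 2) (hβ₁ : 0 < β₁) (hl₀ : l₀ ∈ Set.Ioo (0:ℝ) 1)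
    (hh : ∀ μ ∈ Set.Ioc (0:ℝ) l₀,
      0 < β₁' - 2 * β₁ / (2 - α) * Real.log μ + C₀ * μ ^ (2 - α))
    (F : ℝ → ℝ)
    (hF : ∀ l ∈ Set.Ioc (0:ℝ) l₀,
      F l = ∫ μ in l..l₀, μ ^ (-(α / 2 + 1)) *
        (β₁' - 2 * β₁ / (2 - α) * Real.log μ + C₀ * μ ^ (2 - α)) ^ (-(1:ℝ) / 2))
    (K : ℕ) (hK : 2 ≤ K) (A a₁ a₂ a₃ a₄ : ℝ)
    (hA : 0 < A) (ha₁ : 0 < a₁) (ha₂ : 0 < a₂) (ha₃ : 0 < a₃) (ha₄ : 0 < a₄) :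
    ∃ C sss : ℝ, 0 < C ∧ 0 < sss ∧
      ∀ sstar s₁ : ℝ, Real.exp 1 ≤ sstar → sstar ≤ s₁ →
      ∀ lam b dlam : ℝ → ℝ,
      (∀ s ∈ Set.Icc sstar s₁, lam s ∈ Set.Ioo (0:ℝ) l₀) →
      (∀ s ∈ Set.Icc sstar s₁, HasDerivAt lam (dlam s) s) →
      (∀ s ∈ Set.Icc sstar s₁, 0 < b s) →
      (∀ s ∈ Set.Icc sstar s₁,
        |dlam s / lam s + b s| ≤ s ^ (-((K : ℝ) + 1))) →
      (∀ s ∈ Set.Icc sstar s₁,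
        |b s ^ 2 - lam s ^ α *
            (β₁' - 2 * β₁ / (2 - α) * Real.log (lam s) + C₀ * lam s ^ (2 - α))| ≤
          A * s ^ (-4 : ℝ)) →
      (∀ s ∈ Set.Icc sstar s₁, a₁ * s ^ (-1 : ℝ) ≤ b s ∧ b s ≤ a₂ * s ^ (-1 : ℝ)) →
      (∀ s ∈ Set.Icc sstar s₁,
        a₃ * s ^ (-2 : ℝ) ≤ lam s ^ α * |Real.log (lam s)| ∧
          lam s ^ α * |Real.log (lam s)| ≤ a₄ * s ^ (-2 : ℝ)) →
      ∀ s ∈ Set.Icc (max sstar sss) s₁,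
        ∃ d : ℝ, HasDerivAt (fun τ => F (lam τ)) d s ∧ |d - 1| ≤ C * s ^ (-2 : ℝ) := by
  have hcont : ContinuousOn (fun μ : ℝ => μ ^ (-(α / 2 + 1)) *
      (β₁' - 2 * β₁ / (2 - α) * Real.log μ + C₀ * μ ^ (2 - α)) ^ (-(1:ℝ) / 2))
      (Set.Ioc 0 l₀) := by
    intro μ hμ
    have hμ0 : μ ≠ 0 := hμ.1.ne'
    have hpow (p : ℝ) : ContinuousAt (fun x : ℝ => x ^ p) μ :=
      Real.continuousAt_rpow_const μ p (Or.inl hμ0)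
    have hlog : ContinuousAt Real.log μ := Real.continuousAt_log hμ0
    refine ((hpow _).mul (ContinuousAt.rpow_const ?_ (Or.inl (hh μ hμ).ne'))).continuousWithinAt
    exact (continuousAt_const.sub (continuousAt_const.mul hlog)).add
      (continuousAt_const.mul (hpow _))
  refine ⟨2 * (A / a₁ + 1) / a₁, 1 + 2 * A / a₁ ^ 2, by positivity, by positivity, ?_⟩
  intro sstar s₁ _ _ lam b dlam hlam hdlam _ hmod hen hb _ s hs
  have hs' : s ∈ Set.Icc sstar s₁ := ⟨(le_max_left _ _).trans hs.1, hs.2⟩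
  have hss : 1 + 2 * A / a₁ ^ 2 ≤ s := (le_max_right _ _).trans hs.1
  have hfrac : 0 < 2 * A / a₁ ^ 2 := by positivity
  have hs1 : 1 ≤ s := by linarith
  have hs0 : 0 < s := by linarith
  have hl := hlam s hs'
  have hhl := hh (lam s) (Set.Ioo_subset_Ioc_self hl)
  have hmod := hmod s hs'
  have hen := hen s hs'
  have hb := (hb s hs').1
  refine ⟨_, (hasDerivAt_of_eq_integral_left hcont hF hl).comp s (hdlam s hs'), ?_⟩
  set H := β₁' - 2 * β₁ / (2 - α) * Real.log (lam s) + C₀ * lam s ^ (2 - α)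
  have hpow_inv (n : ℕ) : s ^ (-(n : ℝ)) = s⁻¹ ^ n := by
    rw [Real.rpow_neg hs0.le, Real.rpow_natCast, inv_pow]
  have h1 : s ^ (-1 : ℝ) = s⁻¹ := by simpa using hpow_inv 1
  have h2 : s ^ (-2 : ℝ) = s⁻¹ ^ 2 := by exact_mod_cast hpow_inv 2
  have h4 : s ^ (-4 : ℝ) = s⁻¹ ^ 4 := by exact_mod_cast hpow_inv 4
  have hK3 : s ^ (-((K : ℝ) + 1)) ≤ s⁻¹ ^ 3 := by
    rw [← hpow_inv 3]
    refine Real.rpow_le_rpow_of_exponent_le hs1 ?_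
    have : (2 : ℝ) ≤ K := by exact_mod_cast hK
    push_cast
    linarith
  have hg_pos : 0 < lam s ^ (α / 2) * H ^ ((1 : ℝ) / 2) :=
    mul_pos (Real.rpow_pos_of_pos hl.1 _) (Real.rpow_pos_of_pos hhl _)
  have hg_sq : (lam s ^ (α / 2) * H ^ ((1 : ℝ) / 2)) ^ 2 = lam s ^ α * H := by
    rw [mul_pow, ← Real.rpow_mul_natCast hl.1.le, ← Real.rpow_mul_natCast hhl.le]
    norm_num
  have hd : -(lam s ^ (-(α / 2 + 1)) * H ^ (-(1 : ℝ) / 2)) * dlam s =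
      -(dlam s / lam s) / (lam s ^ (α / 2) * H ^ ((1 : ℝ) / 2)) := by
    rw [Real.rpow_neg hl.1.le, Real.rpow_add_one hl.1.ne', neg_div, Real.rpow_neg hhl.le]
    have := hl.1.ne'
    field_simp
  have hsmall : 2 * A * s⁻¹ ^ 2 ≤ a₁ ^ 2 := by
    have : 2 * A / a₁ ^ 2 ≤ s ^ 2 := by nlinarith
    rw [div_le_iff₀ (by positivity)] at this
    rw [inv_pow, ← div_eq_mul_inv, div_le_iff₀ (by positivity)]
    linarith
  rw [hd, h2]
  refine abs_div_sub_one_le_of_sq_close hA ha₁ (inv_pos.mpr hs0) hg_pos (h1 ▸ hb) ?_ ?_ hsmall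
  · rwa [hg_sq, ← h4]
  · rw [← neg_add', abs_neg]
    exact hmod.trans hK3
end
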